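/- arXiv:2505.13184 — 3 statements merged into one kernel-verified Lean document; each statement's English description precedes it below -/
import Mathlib

section
/- With c_back^{(M)} := sup_{t ∈ 𝒯_M} sSup σ(B^{(M)}_t) and c_over^{(M)} := inf_{t ∈ 𝒯_M} sInf σ(B^{(M)}_t): the sequence (c_back^{(M)})_{M≥1} is nondecreasing, the sequence (c_over^{(M)})_{M≥1} is nonincreasing, and for all integers M ≥ 1 and L ≥ 1 one has c_back^{(M+L)} ≥ −1 − c_over^{(M)} and c_over^{(M+L)} ≤ −1 − c_back^{(M)}. -/
open MeasureTheory Filter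

noncomputable section

namespace QB

/-- Lebesgue measure on the positive half-line. -/
abbrev μp : Measure ℝ := volume.restrict (Set.Ioi (0:ℝ))

/-- The Hilbert space `L²((0,∞))`. -/
abbrev Hp : Type := Lp ℂ 2 μp

/-- The Hilbert space `L²(ℝ)`. -/
abbrev HL : Type := Lp ℂ 2 (volume : Measure ℝ)

/-- The defining properties of the operators: `S t` is multiplication by `e^{-i k² t}`,
`R` is the isometry "extend by zero and apply the inverse Fourier–Plancherel transform"
(characterised by its isometry property together with the integral formula on
integrable elements of `L²((0,∞))`, which determine it uniquely by continuity and density),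
and `Pm` is the orthogonal projection onto functions supported in `(-∞,0)`. -/
structure Setup (S : ℝ → Hp →L[ℂ] Hp) (R : Hp →L[ℂ] HL) (Pm : HL →L[ℂ] HL) : Prop where
  hS : ∀ (t : ℝ) (φ : Hp),
    (S t φ : ℝ → ℂ) =ᵐ[μp] fun k => Complex.exp (-Complex.I * (k:ℂ)^2 * (t:ℂ)) * φ k
  hR_isometry : ∀ φ : Hp, ‖R φ‖ = ‖φ‖
  hR : ∀ φ : Hp, Integrable (φ : ℝ → ℂ) μp →
    (R φ : ℝ → ℂ) =ᵐ[volume]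
      fun x => (((2 * Real.pi) ^ (-(1/2) : ℝ) : ℝ) : ℂ) *
        ∫ k in Set.Ioi (0:ℝ), Complex.exp (Complex.I * (x:ℂ) * (k:ℂ)) * φ k
  hPm : ∀ ψ : HL, (Pm ψ : ℝ → ℂ) =ᵐ[volume] Set.indicator (Set.Iio (0:ℝ)) (fun x => ψ x)

/-- The single backflow operator `B_{⟨t₁,t₂⟩} = S_{t₂}* R* Π⁻ R S_{t₂} − S_{t₁}* R* Π⁻ R S_{t₁}`. -/
def B1 (S : ℝ → Hp →L[ℂ] Hp) (R : Hp →L[ℂ] HL) (Pm : HL →L[ℂ] HL) (t₁ t₂ : ℝ) :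
    Hp →L[ℂ] Hp :=
  (ContinuousLinearMap.adjoint (S t₂)).comp ((ContinuousLinearMap.adjoint R).comp
    (Pm.comp (R.comp (S t₂))))
  - (ContinuousLinearMap.adjoint (S t₁)).comp ((ContinuousLinearMap.adjoint R).comp
    (Pm.comp (R.comp (S t₁))))

/-- The `M`-fold backflow operator `B^{(M)}_t = Σ_{j=1}^M B_{⟨t_{2j-1}, t_{2j}⟩}`
(zero-based indexing of the tuple `t`). -/
def BM (S : ℝ → Hp →L[ℂ] Hp) (R : Hp →L[ℂ] HL) (Pm : HL →L[ℂ] HL) (M : ℕ)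
    (t : Fin (2*M) → ℝ) : Hp →L[ℂ] Hp :=
  ∑ j : Fin M, B1 S R Pm (t ⟨2*j.1, by have := j.isLt; omega⟩)
    (t ⟨2*j.1+1, by have := j.isLt; omega⟩)

/-- `𝒯_M`: the set of strictly increasing `2M`-tuples of reals. -/
def TM (M : ℕ) : Set (Fin (2*M) → ℝ) := {t | StrictMono t}

/-- The `M`-th backflow constant `c_back^{(M)} = sup_{t ∈ 𝒯_M} sSup σ(B^{(M)}_t)`. -/
def cback (S : ℝ → Hp →L[ℂ] Hp) (R : Hp →L[ℂ] HL) (Pm : HL →L[ℂ] HL) (M : ℕ) : ℝ :=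
  sSup ((fun t => sSup (spectrum ℝ (BM S R Pm M t))) '' TM M)

/-- The `M`-th overflow constant `c_over^{(M)} = inf_{t ∈ 𝒯_M} sInf σ(B^{(M)}_t)`. -/
def cover (S : ℝ → Hp →L[ℂ] Hp) (R : Hp →L[ℂ] HL) (Pm : HL →L[ℂ] HL) (M : ℕ) : ℝ :=
  sInf ((fun t => sInf (spectrum ℝ (BM S R Pm M t))) '' TM M)

section Spectral

variable {E : Type*} [NormedAddCommGroup E] [InnerProductSpace ℂ E]

lemma reApplyInnerSelf_smul_one (c : ℝ) (x : E) :
    (algebraMap ℝ (E →L[ℂ] E) c).reApplyInnerSelf x = c * ‖x‖ ^ 2 := by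
  rw [ContinuousLinearMap.reApplyInnerSelf_apply, Algebra.algebraMap_eq_smul_one]
  simp only [FunLike.coe_smul, Pi.smul_apply, one_apply_eq_self]
  rw [show (c • x) = (c : ℂ) • x from rfl, inner_smul_left, inner_self_eq_norm_sq_to_K]
  simp [← Complex.ofReal_pow]

lemma reApplyInnerSelf_sub (A B : E →L[ℂ] E) (x : E) :
    (A - B).reApplyInnerSelf x = A.reApplyInnerSelf x - B.reApplyInnerSelf x := by
  simp [ContinuousLinearMap.reApplyInnerSelf_apply, inner_sub_left]

variable [CompleteSpace E]

lemma sSup_spectrum_le_iff [Nontrivial E] {A : E →L[ℂ] E} (hA : IsSelfAdjoint A) {c : ℝ} :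
    sSup (spectrum ℝ A) ≤ c ↔ ∀ x, A.reApplyInnerSelf x ≤ c * ‖x‖ ^ 2 := by
  have hc : IsSelfAdjoint (algebraMap ℝ (E →L[ℂ] E) c) := IsSelfAdjoint.algebraMap _ (.all c)
  rw [csSup_le_iff (spectrum.isCompact A).bddAbove
      (ContinuousFunctionalCalculus.spectrum_nonempty A hA),
    ← le_algebraMap_iff_spectrum_le hA, ContinuousLinearMap.le_def,
    ContinuousLinearMap.isPositive_def', and_iff_right (hc.sub hA)]
  simp_rw [reApplyInnerSelf_sub, reApplyInnerSelf_smul_one, sub_nonneg]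

lemma le_sInf_spectrum_iff [Nontrivial E] {A : E →L[ℂ] E} (hA : IsSelfAdjoint A) {c : ℝ} :
    c ≤ sInf (spectrum ℝ A) ↔ ∀ x, c * ‖x‖ ^ 2 ≤ A.reApplyInnerSelf x := by
  have hc : IsSelfAdjoint (algebraMap ℝ (E →L[ℂ] E) c) := IsSelfAdjoint.algebraMap _ (.all c)
  rw [le_csInf_iff (spectrum.isCompact A).bddBelow
      (ContinuousFunctionalCalculus.spectrum_nonempty A hA),
    ← algebraMap_le_iff_le_spectrum hA, ContinuousLinearMap.le_def,
    ContinuousLinearMap.isPositive_def', and_iff_right (hA.sub hc)]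
  simp_rw [reApplyInnerSelf_sub, reApplyInnerSelf_smul_one, sub_nonneg]

end Spectral

instance : Nontrivial Hp := by
  have hm : μp (Set.Ioc (0:ℝ) 1) = 1 := by
    rw [Measure.restrict_apply measurableSet_Ioc,
      Set.inter_eq_left.2 Set.Ioc_subset_Ioi_self]
    simp
  refine ⟨indicatorConstLp 2 (measurableSet_Ioc (a := (0:ℝ)) (b := 1)) (by simp [hm]) (1:ℂ), 0, ?_⟩
  rw [← norm_ne_zero_iff, norm_indicatorConstLp (by simp) (by simp), measureReal_def, hm]
  simp

/-- The probability of finding the particle on the negative half-line at time `t`. -/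
def leftProb (S : ℝ → Hp →L[ℂ] Hp) (R : Hp →L[ℂ] HL) (Pm : HL →L[ℂ] HL)
    (φ : Hp) (t : ℝ) : ℝ := ‖Pm (R (S t φ))‖ ^ 2

namespace Setup

variable {S : ℝ → Hp →L[ℂ] Hp} {R : Hp →L[ℂ] HL} {Pm : HL →L[ℂ] HL}

lemma norm_S (h : Setup S R Pm) (t : ℝ) (φ : Hp) : ‖S t φ‖ = ‖φ‖ := by
  rw [Lp.norm_def, Lp.norm_def]
  congr 1
  refine eLpNorm_congr_norm_ae ?_
  filter_upwards [h.hS t φ] with k hk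
  rw [hk, norm_mul, Complex.norm_exp]
  simp [← Complex.ofReal_pow]

lemma inner_Pm (h : Setup S R Pm) (ψ χ : HL) :
    inner ℂ (Pm ψ) (Pm χ) = inner ℂ (Pm ψ) χ := by
  rw [L2.inner_def, L2.inner_def]
  refine integral_congr_ae ?_
  filter_upwards [h.hPm ψ, h.hPm χ] with x h1 h2
  rw [h1, h2]
  by_cases hx : x ∈ Set.Iio (0:ℝ) <;> simp [hx]

lemma adjoint_Pm_comp (h : Setup S R Pm) :
    (ContinuousLinearMap.adjoint Pm).comp Pm = Pm := by
  ext1 ψ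
  refine ext_inner_left ℂ fun χ => ?_
  rw [ContinuousLinearMap.comp_apply, ContinuousLinearMap.adjoint_inner_right,
    ← inner_conj_symm, h.inner_Pm, inner_conj_symm]

lemma norm_sub_Pm_sq (h : Setup S R Pm) (ψ : HL) :
    ‖ψ - Pm ψ‖ ^ 2 = ‖ψ‖ ^ 2 - ‖Pm ψ‖ ^ 2 := by
  have h1 := h.inner_Pm ψ ψ
  rw [inner_self_eq_norm_sq_to_K] at h1
  rw [@norm_sub_sq ℂ, ← inner_conj_symm, ← h1]
  simp [← Complex.ofReal_pow]
  ring

lemma B1_eq (h : Setup S R Pm) (t₁ t₂ : ℝ) : B1 S R Pm t₁ t₂ =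
    (ContinuousLinearMap.adjoint (Pm.comp (R.comp (S t₂)))).comp (Pm.comp (R.comp (S t₂))) -
    (ContinuousLinearMap.adjoint (Pm.comp (R.comp (S t₁)))).comp (Pm.comp (R.comp (S t₁))) := by
  have key : ∀ t, (ContinuousLinearMap.adjoint (S t)).comp ((ContinuousLinearMap.adjoint R).comp
      (Pm.comp (R.comp (S t)))) =
    (ContinuousLinearMap.adjoint (Pm.comp (R.comp (S t)))).comp (Pm.comp (R.comp (S t))) := by
    intro t
    conv_lhs => rw [← h.adjoint_Pm_comp]
    simp only [ContinuousLinearMap.adjoint_comp, ContinuousLinearMap.comp_assoc]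
  rw [B1, key, key]

lemma isSelfAdjoint_BM (h : Setup S R Pm) (M : ℕ) (t : Fin (2*M) → ℝ) :
    IsSelfAdjoint (BM S R Pm M t) := by
  refine isSelfAdjoint_sum _ fun j _ => ?_
  rw [h.B1_eq]
  exact (ContinuousLinearMap.isPositive_adjoint_comp_self _).isSelfAdjoint.sub
    (ContinuousLinearMap.isPositive_adjoint_comp_self _).isSelfAdjoint

lemma reApplyInnerSelf_BM (h : Setup S R Pm) (M : ℕ) (t : Fin (2*M) → ℝ) (φ : Hp) :
    (BM S R Pm M t).reApplyInnerSelf φ = ∑ j : Fin M,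
      (leftProb S R Pm φ (t ⟨2*j.1+1, by have := j.isLt; omega⟩) -
        leftProb S R Pm φ (t ⟨2*j.1, by have := j.isLt; omega⟩)) := by
  simp_rw [ContinuousLinearMap.reApplyInnerSelf_apply, BM, h.B1_eq,
    sum_apply, sum_inner, map_sum, sub_apply,
    inner_sub_left, map_sub, leftProb]
  simp only [ContinuousLinearMap.comp_apply (ContinuousLinearMap.adjoint _),
    ContinuousLinearMap.adjoint_inner_left, inner_self_eq_norm_sq]
  rfl

lemma leftProb_nonneg (φ : Hp) (t : ℝ) : 0 ≤ leftProb S R Pm φ t := sq_nonneg _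

lemma leftProb_le (h : Setup S R Pm) (φ : Hp) (t : ℝ) : leftProb S R Pm φ t ≤ ‖φ‖ ^ 2 := by
  have := h.norm_sub_Pm_sq (R (S t φ))
  rw [h.hR_isometry, h.norm_S] at this
  rw [leftProb]
  nlinarith [sq_nonneg ‖R (S t φ) - Pm (R (S t φ))‖]

end Setup

lemma abs_sub_two_mul_mul {x t k : ℝ} (hk : 0 ≤ k) (hxt : x * t ≤ 0) :
    |x - 2 * k * t| = |x| + 2 * k * |t| := by
  have h1 : |2 * k * t| = 2 * k * |t| := by rw [abs_mul, abs_of_nonneg (by positivity)]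
  rw [← h1, ← abs_neg (2 * k * t), sub_eq_add_neg, abs_add_eq_add_abs_iff]
  rcases mul_nonpos_iff.1 hxt with ⟨hx, ht⟩ | ⟨hx, ht⟩
  · exact .inl ⟨hx, by nlinarith⟩
  · exact .inr ⟨hx, by nlinarith⟩

open scoped ContDiff in
/-- Non-stationary phase estimate for the free Schrödinger evolution of a positive-momentum
wave packet in the classically forbidden region. -/
lemma exists_norm_integral_le {g : ℝ → ℝ} (hg : ContDiff ℝ ∞ g) (hc : HasCompactSupport g)
    (hs : tsupport g ⊆ Set.Ioi 0) :
    ∃ C a : ℝ, 0 ≤ C ∧ 0 < a ∧ ∀ x t : ℝ, t ≠ 0 → x * t ≤ 0 →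
      ‖∫ k in Set.Ioi (0:ℝ), Complex.exp (Complex.I * (x:ℂ) * (k:ℂ)) *
        (Complex.exp (-Complex.I * (k:ℂ)^2 * (t:ℂ)) * (g k : ℂ))‖ ≤ C / (|x| + a * |t|) := by
  obtain ⟨a, b, ha, hab, hsab⟩ : ∃ a b : ℝ, 0 < a ∧ a < b ∧ tsupport g ⊆ Set.Ioo a b := by
    have hK : IsCompact (insert 1 (tsupport g)) := hc.isCompact.insert 1
    obtain ⟨m, hm, hmle⟩ := hK.exists_isLeast (Set.insert_nonempty _ _)
    obtain ⟨n, hn, hnle⟩ := hK.exists_isGreatest (Set.insert_nonempty _ _)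
    have hm0 : 0 < m := by
      rcases hm with rfl | hm
      · exact one_pos
      · exact hs hm
    refine ⟨m / 2, n + 1, by positivity, by linarith [hmle hn], fun x hx => ⟨?_, ?_⟩⟩
    · linarith [hmle (Set.mem_insert_of_mem _ hx)]
    · linarith [hnle (Set.mem_insert_of_mem _ hx)]
  obtain ⟨G₀, hG₀⟩ := hg.continuous.bounded_above_of_compact_support hc
  have hg' : Continuous (deriv g) := hg.continuous_deriv (by simp)
  obtain ⟨G₁, hG₁⟩ := hg'.bounded_above_of_compact_support hc.deriv
  have hG₀0 : 0 ≤ G₀ := (norm_nonneg _).trans (hG₀ 0)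
  have hG₁0 : 0 ≤ G₁ := (norm_nonneg _).trans (hG₁ 0)
  have hgz : ∀ k, k ∉ Set.Ioo a b → g k = 0 := fun k hk =>
    image_eq_zero_of_notMem_tsupport fun h => hk (hsab h)
  refine ⟨(G₁ + G₀ / a) * |b - a|, 2 * a, by positivity, by positivity, fun x t ht hxt => ?_⟩
  have htp : 0 < |t| := abs_pos.2 ht
  set D : ℝ := |x| + 2 * a * |t| with hD
  have hDpos : 0 < D := by positivity
  set θ : ℝ → ℝ := fun k => x - 2 * k * t with hθ
  have hθD : ∀ k ∈ Set.Icc a b, D ≤ |θ k| := fun k hk => by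
    rw [hθ, abs_sub_two_mul_mul (ha.le.trans hk.1) hxt, hD]
    nlinarith [hk.1]
  have hθ0 : ∀ k ∈ Set.Icc a b, Complex.I * (θ k : ℂ) ≠ 0 := fun k hk => by
    have : θ k ≠ 0 := abs_pos.1 (hDpos.trans_le (hθD k hk))
    simp [this]
  set v : ℝ → ℂ := fun k => Complex.exp (Complex.I * (x * k - k ^ 2 * t))
  set v' : ℝ → ℂ := fun k => v k * (Complex.I * θ k)
  set u : ℝ → ℂ := fun k => g k / (Complex.I * θ k)
  set u' : ℝ → ℂ := fun k => ((deriv g k : ℝ) : ℂ) / (Complex.I * θ k) +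
    g k * (2 * Complex.I * t) / (Complex.I * θ k) ^ 2
  have hvn : ∀ k, ‖v k‖ = 1 := fun k => by
    simp only [v]
    rw [mul_comm, ← Complex.ofReal_pow, ← Complex.ofReal_mul, ← Complex.ofReal_mul,
      ← Complex.ofReal_sub, Complex.norm_exp_ofReal_mul_I]
  have hvd : ∀ k, HasDerivAt v (v' k) k := fun k => by
    have h1 : HasDerivAt (fun k : ℝ => (k : ℂ)) 1 k := Complex.ofRealCLM.hasDerivAt
    have h2 := (((h1.const_mul (x : ℂ)).sub ((h1.pow 2).mul_const (t : ℂ))).const_mul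
      Complex.I).cexp
    refine h2.congr_deriv ?_
    simp only [v', v, hθ]
    push_cast
    simp
  have hθc : Continuous fun k => (θ k : ℂ) := by fun_prop
  have hud : ∀ k ∈ Set.uIcc a b, HasDerivAt u (u' k) k := fun k hk => by
    rw [Set.uIcc_of_le hab.le] at hk
    have hne := hθ0 k hk
    have h1 : HasDerivAt (fun k : ℝ => (g k : ℂ)) ((deriv g k : ℝ) : ℂ) k :=
      ((hg.differentiable (by simp)) k).hasDerivAt.ofReal_comp
    have h2 : HasDerivAt (fun k : ℝ => (θ k : ℂ)) ((-(2 * t) : ℝ) : ℂ) k := by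
      refine HasDerivAt.ofReal_comp ?_
      have := (((hasDerivAt_id k).const_mul 2).mul_const t).const_sub x
      simpa [hθ] using this
    refine (h1.div (h2.const_mul Complex.I) hne).congr_deriv ?_
    simp only [u']
    field_simp
    push_cast
    ring
  have hvc : Continuous v := by fun_prop
  have hv'c : Continuous v' := by fun_prop
  have hu'c : ContinuousOn u' (Set.uIcc a b) := by
    rw [Set.uIcc_of_le hab.le]
    have hgc := hg.continuous
    refine ContinuousOn.add (ContinuousOn.div (by fun_prop) (by fun_prop) hθ0)
      (ContinuousOn.div (by fun_prop) (by fun_prop) fun k hk => pow_ne_zero 2 (hθ0 k hk))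
  have hparts := intervalIntegral.integral_mul_deriv_eq_deriv_mul hud (fun k _ => hvd k)
    hu'c.intervalIntegrable (hv'c.intervalIntegrable a b)
  have hua : u a = 0 := by simp [u, hgz a (by simp)]
  have hub : u b = 0 := by simp [u, hgz b (by simp)]
  rw [hua, hub, zero_mul, zero_mul, sub_zero, zero_sub] at hparts
  have heq : ∫ k in Set.Ioi (0:ℝ), Complex.exp (Complex.I * (x:ℂ) * (k:ℂ)) *
        (Complex.exp (-Complex.I * (k:ℂ)^2 * (t:ℂ)) * (g k : ℂ)) = ∫ k in a..b, u k * v' k := by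
    rw [intervalIntegral.integral_of_le hab.le]
    rw [setIntegral_eq_of_subset_of_forall_sdiff_eq_zero measurableSet_Ioi
      (s := Set.Ioc a b) (fun k hk => ha.trans hk.1)]
    · refine setIntegral_congr_fun measurableSet_Ioc fun k hk => ?_
      have hne := hθ0 k ⟨hk.1.le, hk.2⟩
      simp only [u, v', v]
      rw [← mul_assoc, ← Complex.exp_add, mul_comm (Complex.exp _) (Complex.I * _), ← mul_assoc,
        div_mul_cancel₀ _ hne, mul_comm]
      congr 2
      ring
    · intro k hk
      simp [hgz k fun h => hk.2 ⟨h.1, h.2.le⟩]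
  rw [heq, hparts, norm_neg]
  calc ‖∫ k in a..b, u' k * v k‖ ≤ (G₁ + G₀ / a) / D * |b - a| := by
        refine intervalIntegral.norm_integral_le_of_norm_le_const fun k hk => ?_
        rw [Set.uIoc_of_le hab.le] at hk
        have hk' := hθD k ⟨hk.1.le, hk.2⟩
        rw [norm_mul, hvn, mul_one]
        refine (norm_add_le _ _).trans ?_
        simp only [norm_div, norm_mul, norm_pow, Complex.norm_I, Complex.norm_real, one_mul,
          Complex.norm_ofNat, Real.norm_eq_abs, mul_one]
        rw [add_div]
        have hG0' : |g k| ≤ G₀ := hG₀ k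
        have hG1' : |deriv g k| ≤ G₁ := hG₁ k
        refine add_le_add (by gcongr) ?_
        have h2 : 2 * |t| ≤ D / a := by
          rw [le_div_iff₀ ha, hD]
          nlinarith [abs_nonneg x]
        calc |g k| * (2 * |t|) / |θ k| ^ 2 ≤ G₀ * (D / a) / D ^ 2 := by gcongr
          _ = G₀ / a / D := by field_simp
    _ = (G₁ + G₀ / a) * |b - a| / D := by ring

lemma L2_norm_sq_le {ψ : HL} {C c : ℝ} (hc : 0 < c)
    (hψ : ∀ᵐ x : ℝ, ‖ψ x‖ ≤ C / (|x| + c)) : ‖ψ‖ ^ 2 ≤ C ^ 2 * Real.pi / c := by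
  have h1 : ‖ψ‖ ^ 2 = ∫ x, ‖ψ x‖ ^ 2 := by
    have h := L2.inner_def (𝕜 := ℂ) ψ ψ
    simp_rw [inner_self_eq_norm_sq_to_K] at h
    have h' : ((‖ψ‖ ^ 2 : ℝ) : ℂ) = ((∫ x, ‖ψ x‖ ^ 2 : ℝ) : ℂ) := by
      rw [← integral_complex_ofReal]
      simpa using h
    exact_mod_cast h'
  have hint : Integrable fun x : ℝ => (1 + (x / c) ^ 2)⁻¹ :=
    integrable_inv_one_add_sq.comp_div hc.ne'
  rw [h1]
  calc ∫ x, ‖ψ x‖ ^ 2 ≤ ∫ x : ℝ, (C / c) ^ 2 * (1 + (x / c) ^ 2)⁻¹ := by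
        refine integral_mono_of_nonneg (.of_forall fun x => sq_nonneg _) (hint.const_mul _) ?_
        filter_upwards [hψ] with x hx
        calc ‖ψ x‖ ^ 2 ≤ (C / (|x| + c)) ^ 2 := by gcongr
          _ = C ^ 2 / (|x| + c) ^ 2 := div_pow _ _ _
          _ ≤ C ^ 2 / (c ^ 2 + x ^ 2) := by
            gcongr
            nlinarith [sq_abs x, mul_nonneg (abs_nonneg x) hc.le]
          _ = _ := by field_simp
    _ = C ^ 2 * Real.pi / c := by
      rw [integral_const_mul, Measure.integral_comp_div (fun y : ℝ => (1 + y ^ 2)⁻¹),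
        integral_univ_inv_one_add_sq, abs_of_pos hc, smul_eq_mul]
      field_simp

open scoped ContDiff in
/-- The elements of `L²((0,∞))` represented by smooth functions with compact support
in `(0,∞)`. -/
def testFunctions : Set Hp :=
  {φ | ∃ g : ℝ → ℝ, ContDiff ℝ ∞ g ∧ HasCompactSupport g ∧ tsupport g ⊆ Set.Ioi 0 ∧
    (φ : ℝ → ℂ) =ᵐ[μp] fun k => (g k : ℂ)}

lemma topologicalClosure_span_testFunctions :
    (Submodule.span ℂ testFunctions).topologicalClosure = ⊤ := by
  rw [Submodule.topologicalClosure_eq_top_iff, Submodule.eq_bot_iff]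
  intro f hf
  have hz : ∀ᵐ x ∂μp, x ∈ Set.Ioi (0:ℝ) → f x = 0 := by
    refine isOpen_Ioi.ae_eq_zero_of_integral_contDiff_smul_eq_zero
      (((Lp.memLp f).locallyIntegrable (by norm_num)).locallyIntegrableOn _) ?_
    intro g hg hc hs
    have hmem : MemLp (fun k => (g k : ℂ)) 2 μp :=
      (Complex.continuous_ofReal.comp hg.continuous).memLp_of_hasCompactSupport
        (hc.comp_left (g := Complex.ofReal) rfl)
    have h0 := (Submodule.mem_orthogonal _ _).1 hf (hmem.toLp _)
      (Submodule.subset_span ⟨g, hg, hc, hs, hmem.coeFn_toLp⟩)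
    rw [L2.inner_def] at h0
    rw [← h0]
    refine integral_congr_ae ?_
    filter_upwards [hmem.coeFn_toLp] with k hk
    rw [hk]
    simp [mul_comm]
  rw [Lp.eq_zero_iff_ae_eq_zero]
  filter_upwards [hz, ae_restrict_mem measurableSet_Ioi] with x hx hx0 using hx hx0

lemma tendsto_zero_of_testFunctions {T : ℝ → Hp →L[ℂ] HL} {l : Filter ℝ}
    (hT : ∀ t φ, ‖T t φ‖ ≤ ‖φ‖)
    (h : ∀ φ ∈ testFunctions, Tendsto (fun t => T t φ) l (nhds 0)) (φ : Hp) :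
    Tendsto (fun t => T t φ) l (nhds 0) := by
  have hspan : ∀ φ ∈ Submodule.span ℂ testFunctions, Tendsto (fun t => T t φ) l (nhds 0) := by
    intro φ hφ
    induction hφ using Submodule.span_induction with
    | mem φ hφ => exact h φ hφ
    | zero => simpa using tendsto_const_nhds
    | add φ χ _ _ hφ hχ => simpa using hφ.add hχ
    | smul c φ _ hφ => simpa using hφ.const_smul c
  have hφ : φ ∈ closure (Submodule.span ℂ testFunctions : Set Hp) := by
    rw [← Submodule.topologicalClosure_coe, topologicalClosure_span_testFunctions]
    trivial
  rw [Metric.tendsto_nhds]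
  intro ε hε
  obtain ⟨χ, hχ, hd⟩ := Metric.mem_closure_iff.1 hφ (ε / 2) (half_pos hε)
  filter_upwards [Metric.tendsto_nhds.1 (hspan χ hχ) (ε / 2) (half_pos hε)] with t ht
  rw [dist_zero_right] at ht ⊢
  rw [dist_eq_norm] at hd
  calc ‖T t φ‖ = ‖T t (φ - χ) + T t χ‖ := by rw [map_sub, sub_add_cancel]
    _ ≤ ‖T t (φ - χ)‖ + ‖T t χ‖ := norm_add_le _ _
    _ < ε := by linarith [hT t (φ - χ)]

namespace Setup

variable {S : ℝ → Hp →L[ℂ] Hp} {R : Hp →L[ℂ] HL} {Pm : HL →L[ℂ] HL}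

lemma exists_norm_R_S_le (h : Setup S R Pm) {φ : Hp} (hφ : φ ∈ testFunctions) :
    ∃ C a : ℝ, 0 ≤ C ∧ 0 < a ∧ ∀ t : ℝ, t ≠ 0 →
      ∀ᵐ x : ℝ, x * t ≤ 0 → ‖R (S t φ) x‖ ≤ C / (|x| + a * |t|) := by
  obtain ⟨g, hg, hc, hs, hφg⟩ := hφ
  obtain ⟨C, a, hC, ha, hb⟩ := exists_norm_integral_le hg hc hs
  refine ⟨(2 * Real.pi) ^ (-(1/2) : ℝ) * C, a, by positivity, ha, fun t ht => ?_⟩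
  have hSg : (S t φ : ℝ → ℂ) =ᵐ[μp]
      fun k => Complex.exp (-Complex.I * (k:ℂ)^2 * (t:ℂ)) * (g k : ℂ) := by
    filter_upwards [h.hS t φ, hφg] with k h1 h2
    rw [h1, h2]
  have hint : Integrable (S t φ : ℝ → ℂ) μp := by
    refine Integrable.congr ?_ hSg.symm
    have hgc := hg.continuous
    refine Integrable.mono_measure ?_ Measure.restrict_le_self
    refine Continuous.integrable_of_hasCompactSupport (by fun_prop) ?_
    exact (hc.comp_left (g := Complex.ofReal) rfl).mul_left
  filter_upwards [h.hR _ hint] with x hx hxt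
  rw [hx, norm_mul, Complex.norm_real, Real.norm_of_nonneg (by positivity), mul_div_assoc]
  gcongr
  refine le_of_eq_of_le ?_ (hb x t ht hxt)
  congr 1
  refine integral_congr_ae ?_
  filter_upwards [hSg] with k hk
  rw [hk]

lemma tendsto_of_norm_R_S_le {φ : Hp} {C a : ℝ} (ha : 0 < a)
    {T : ℝ → Hp →L[ℂ] HL} {l : Filter ℝ} (hl : Tendsto (fun t : ℝ => |t|) l atTop)
    (hT : ∀ᶠ t in l, ∀ᵐ x : ℝ, ‖T t φ x‖ ≤ C / (|x| + a * |t|)) :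
    Tendsto (fun t => T t φ) l (nhds 0) := by
  rw [tendsto_zero_iff_norm_tendsto_zero]
  have hsq : Tendsto (fun t => ‖T t φ‖ ^ 2) l (nhds 0) := by
    refine squeeze_zero' (.of_forall fun t => sq_nonneg _)
      (g := fun t => C ^ 2 * Real.pi / (a * |t|)) ?_ ?_
    · filter_upwards [hT, hl.eventually_gt_atTop 0] with t ht h0
      exact L2_norm_sq_le (by positivity) ht
    · exact (hl.const_mul_atTop ha).const_div_atTop _
  simpa using hsq.sqrt

lemma norm_Pm_le (h : Setup S R Pm) (ψ : HL) : ‖Pm ψ‖ ≤ ‖ψ‖ := by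
  refine le_of_sq_le_sq ?_ (norm_nonneg _)
  linarith [h.norm_sub_Pm_sq ψ, sq_nonneg ‖ψ - Pm ψ‖]

lemma norm_sub_Pm_le (h : Setup S R Pm) (ψ : HL) : ‖ψ - Pm ψ‖ ≤ ‖ψ‖ := by
  refine le_of_sq_le_sq ?_ (norm_nonneg _)
  linarith [h.norm_sub_Pm_sq ψ, sq_nonneg ‖Pm ψ‖]

lemma tendsto_leftProb_atTop (h : Setup S R Pm) (φ : Hp) :
    Tendsto (leftProb S R Pm φ) atTop (nhds 0) := by
  have key : Tendsto (fun t => (Pm.comp (R.comp (S t))) φ) atTop (nhds 0) := by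
    refine tendsto_zero_of_testFunctions (fun t φ => ?_) (fun φ hφ => ?_) φ
    · exact (h.norm_Pm_le _).trans_eq ((h.hR_isometry _).trans (h.norm_S t φ))
    · obtain ⟨C, a, hC, ha, hb⟩ := h.exists_norm_R_S_le hφ
      refine tendsto_of_norm_R_S_le ha tendsto_abs_atTop_atTop (C := C) ?_
      filter_upwards [eventually_gt_atTop 0] with t ht
      filter_upwards [hb t ht.ne', h.hPm (R (S t φ))] with x hx hP
      simp only [ContinuousLinearMap.comp_apply]
      rw [hP]
      by_cases hx0 : x ∈ Set.Iio (0:ℝ)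
      · rw [Set.indicator_of_mem hx0]
        exact hx (mul_nonpos_of_nonpos_of_nonneg (le_of_lt hx0) ht.le)
      · rw [Set.indicator_of_notMem hx0, norm_zero]
        positivity
  have h2 := key.norm.pow 2
  rw [norm_zero, zero_pow two_ne_zero] at h2
  exact h2

lemma tendsto_leftProb_atBot (h : Setup S R Pm) (φ : Hp) :
    Tendsto (leftProb S R Pm φ) atBot (nhds (‖φ‖ ^ 2)) := by
  have key : Tendsto (fun t => (R.comp (S t) - Pm.comp (R.comp (S t))) φ) atBot (nhds 0) := by
    refine tendsto_zero_of_testFunctions (fun t φ => ?_) (fun φ hφ => ?_) φ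
    · exact (h.norm_sub_Pm_le _).trans_eq ((h.hR_isometry _).trans (h.norm_S t φ))
    · obtain ⟨C, a, hC, ha, hb⟩ := h.exists_norm_R_S_le hφ
      refine tendsto_of_norm_R_S_le ha tendsto_abs_atBot_atTop (C := C) ?_
      filter_upwards [eventually_lt_atBot 0] with t ht
      filter_upwards [hb t ht.ne, h.hPm (R (S t φ)), Lp.coeFn_sub (R (S t φ)) (Pm (R (S t φ)))]
        with x hx hP hsub
      simp only [sub_apply, ContinuousLinearMap.comp_apply]
      rw [hsub, Pi.sub_apply, hP]
      by_cases hx0 : x ∈ Set.Iio (0:ℝ)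
      · rw [Set.indicator_of_mem hx0, sub_self, norm_zero]
        positivity
      · rw [Set.indicator_of_notMem hx0, sub_zero]
        exact hx (mul_nonpos_of_nonneg_of_nonpos (not_lt.1 hx0) ht.le)
  have h2 := (key.norm.pow 2).const_sub (‖φ‖ ^ 2)
  simp only [norm_zero, ne_eq, OfNat.ofNat_ne_zero, not_false_eq_true, zero_pow, sub_zero] at h2
  refine h2.congr fun t => ?_
  have h3 := h.norm_sub_Pm_sq (R (S t φ))
  rw [h.hR_isometry, h.norm_S] at h3
  simp only [sub_apply, ContinuousLinearMap.comp_apply, leftProb]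
  linarith

end Setup

/-- The total change `Σ_j (p(t_{2j}) - p(t_{2j-1}))` of `p` over the intervals given by `t`. -/
def flux (p : ℝ → ℝ) (M : ℕ) (t : Fin (2*M) → ℝ) : ℝ :=
  ∑ j : Fin M, (p (t ⟨2*j.1+1, by have := j.isLt; omega⟩) -
    p (t ⟨2*j.1, by have := j.isLt; omega⟩))

/-- Append the interval `(T, T + 1)` to a tuple of interval endpoints. -/
def appendPair {M : ℕ} (t : Fin (2*M) → ℝ) (T : ℝ) : Fin (2*(M+1)) → ℝ :=
  fun i => if h : i.1 < 2*M then t ⟨i.1, h⟩ else T + ((i.1 : ℝ) - 2*M)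

/-- Put `s₀` in front of a tuple and `s₁` behind it. -/
def surround {M : ℕ} (t : Fin (2*M) → ℝ) (s₀ s₁ : ℝ) (n : ℕ) : ℝ :=
  if n = 0 then s₀ else if h : n - 1 < 2*M then t ⟨n - 1, h⟩ else s₁

lemma appendPair_mem_TM {M : ℕ} {t : Fin (2*M) → ℝ} (ht : t ∈ TM M) {T : ℝ}
    (hT : ∀ i, t i < T) : appendPair t T ∈ TM (M+1) := by
  intro i j hij
  have hij' : i.1 < j.1 := hij
  have hr : (i.1 : ℝ) < j.1 := by exact_mod_cast hij'
  simp only [appendPair]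
  split_ifs with h1 h2 h2
  · exact ht hij'
  · have h3 : ((2 * M : ℕ) : ℝ) ≤ j.1 := by exact_mod_cast not_lt.1 h2
    push_cast at h3
    linarith [hT ⟨i.1, h1⟩]
  · omega
  · linarith

lemma surround_mem_TM {M : ℕ} {t : Fin (2*M) → ℝ} (ht : t ∈ TM M) {s₀ s₁ : ℝ}
    (h₀ : ∀ i, s₀ < t i) (h₁ : ∀ i, t i < s₁) (h : s₀ < s₁) :
    (fun i : Fin (2*(M+1)) => surround t s₀ s₁ i.1) ∈ TM (M+1) := by
  intro i j hij
  have hij' : i.1 < j.1 := hij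
  have := j.isLt
  simp only [surround]
  split_ifs with h1 h2 h3 h3 h4 h5 h5
  · omega
  · exact h₀ _
  · exact h
  · omega
  · exact ht (by rw [Fin.mk_lt_mk]; omega)
  · exact h₁ _
  all_goals omega

lemma flux_appendPair (p : ℝ → ℝ) {M : ℕ} (t : Fin (2*M) → ℝ) (T : ℝ) :
    flux p (M+1) (appendPair t T) = flux p M t + (p (T + 1) - p T) := by
  rw [flux, Fin.sum_univ_castSucc, flux]
  congr 1
  · refine Finset.sum_congr rfl fun j _ => ?_
    have := j.isLt
    simp only [appendPair, Fin.val_castSucc]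
    rw [dif_pos (by omega), dif_pos (by omega)]
  · simp [appendPair]

lemma sum_range_alternate (f : ℕ → ℝ) (M : ℕ) :
    ∑ j ∈ Finset.range (M+1), (f (2*j+1) - f (2*j)) =
      -∑ j ∈ Finset.range M, (f (2*j+2) - f (2*j+1)) - f 0 + f (2*M+1) := by
  induction M with
  | zero => simp; ring
  | succ M ih =>
    rw [Finset.sum_range_succ, ih, Finset.sum_range_succ _ M]
    ring_nf

lemma flux_surround (p : ℝ → ℝ) {M : ℕ} (t : Fin (2*M) → ℝ) (s₀ s₁ : ℝ) :
    flux p (M+1) (fun i => surround t s₀ s₁ i.1) = -flux p M t - p s₀ + p s₁ := by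
  have h1 := sum_range_alternate (fun n => p (surround t s₀ s₁ n)) M
  rw [← Fin.sum_univ_eq_sum_range
      (fun j => p (surround t s₀ s₁ (2*j+1)) - p (surround t s₀ s₁ (2*j))),
    ← Fin.sum_univ_eq_sum_range
      (fun j => p (surround t s₀ s₁ (2*j+2)) - p (surround t s₀ s₁ (2*j+1)))] at h1
  rw [flux, h1, flux]
  congr 1
  · congr 2
    refine Finset.sum_congr rfl fun j _ => ?_
    have := j.isLt
    simp only [surround]
    rw [if_neg (by omega), dif_pos (by omega), if_neg (by omega), dif_pos (by omega)]
    rfl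
  · simp [surround]

lemma abs_flux_le {p : ℝ → ℝ} {c : ℝ} (h₀ : ∀ s, 0 ≤ p s) (h₁ : ∀ s, p s ≤ c) (M : ℕ)
    (t : Fin (2*M) → ℝ) : |flux p M t| ≤ M * c := by
  refine (Finset.abs_sum_le_sum_abs _ _).trans ?_
  refine (Finset.sum_le_card_nsmul _ _ c fun j _ => ?_).trans_eq (by simp)
  rw [abs_le]
  constructor <;> linarith [h₀ (t ⟨2*j.1+1, by have := j.isLt; omega⟩),
    h₀ (t ⟨2*j.1, by have := j.isLt; omega⟩), h₁ (t ⟨2*j.1+1, by have := j.isLt; omega⟩),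
    h₁ (t ⟨2*j.1, by have := j.isLt; omega⟩)]

lemma TM_nonempty (M : ℕ) : (TM M).Nonempty :=
  ⟨fun i => (i.1 : ℝ), fun i j hij => by
    have : i.1 < j.1 := hij
    exact Nat.cast_lt.2 this⟩

namespace Setup

variable {S : ℝ → Hp →L[ℂ] Hp} {R : Hp →L[ℂ] HL} {Pm : HL →L[ℂ] HL}

lemma abs_flux_leftProb_le (h : Setup S R Pm) (M : ℕ) (t : Fin (2*M) → ℝ) (φ : Hp) :
    |flux (leftProb S R Pm φ) M t| ≤ M * ‖φ‖ ^ 2 :=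
  abs_flux_le (leftProb_nonneg φ) (h.leftProb_le φ) M t

lemma sSup_spectrum_BM_le_iff (h : Setup S R Pm) {M : ℕ} {t : Fin (2*M) → ℝ} {c : ℝ} :
    sSup (spectrum ℝ (BM S R Pm M t)) ≤ c ↔
      ∀ φ, flux (leftProb S R Pm φ) M t ≤ c * ‖φ‖ ^ 2 := by
  refine (sSup_spectrum_le_iff (h.isSelfAdjoint_BM M t)).trans ?_
  simp_rw [h.reApplyInnerSelf_BM]
  rfl

lemma le_sInf_spectrum_BM_iff (h : Setup S R Pm) {M : ℕ} {t : Fin (2*M) → ℝ} {c : ℝ} :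
    c ≤ sInf (spectrum ℝ (BM S R Pm M t)) ↔
      ∀ φ, c * ‖φ‖ ^ 2 ≤ flux (leftProb S R Pm φ) M t := by
  refine (le_sInf_spectrum_iff (h.isSelfAdjoint_BM M t)).trans ?_
  simp_rw [h.reApplyInnerSelf_BM]
  rfl

lemma cback_le_iff (h : Setup S R Pm) {M : ℕ} {c : ℝ} :
    cback S R Pm M ≤ c ↔
      ∀ t ∈ TM M, ∀ φ, flux (leftProb S R Pm φ) M t ≤ c * ‖φ‖ ^ 2 := by
  have hb : BddAbove ((fun t => sSup (spectrum ℝ (BM S R Pm M t))) '' TM M) := by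
    refine ⟨M, Set.forall_mem_image.2 fun t _ => ?_⟩
    exact h.sSup_spectrum_BM_le_iff.2 fun φ => (abs_le.1 (h.abs_flux_leftProb_le M t φ)).2
  rw [cback, csSup_le_iff hb ((TM_nonempty M).image _), Set.forall_mem_image]
  simp_rw [h.sSup_spectrum_BM_le_iff]

lemma le_cover_iff (h : Setup S R Pm) {M : ℕ} {c : ℝ} :
    c ≤ cover S R Pm M ↔
      ∀ t ∈ TM M, ∀ φ, c * ‖φ‖ ^ 2 ≤ flux (leftProb S R Pm φ) M t := by
  have hb : BddBelow ((fun t => sInf (spectrum ℝ (BM S R Pm M t))) '' TM M) := by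
    refine ⟨-M, Set.forall_mem_image.2 fun t _ => ?_⟩
    refine h.le_sInf_spectrum_BM_iff.2 fun φ => ?_
    linarith [(abs_le.1 (h.abs_flux_leftProb_le M t φ)).1]
  rw [cover, le_csInf_iff hb ((TM_nonempty M).image _), Set.forall_mem_image]
  simp_rw [h.le_sInf_spectrum_BM_iff]

lemma tendsto_flux_appendPair (h : Setup S R Pm) {M : ℕ} (t : Fin (2*M) → ℝ) (φ : Hp) :
    Tendsto (fun T => flux (leftProb S R Pm φ) (M+1) (appendPair t T)) atTop
      (nhds (flux (leftProb S R Pm φ) M t)) := by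
  simp_rw [flux_appendPair]
  have h1 := h.tendsto_leftProb_atTop φ
  have h2 := h1.comp (tendsto_atTop_add_const_right atTop (1:ℝ) tendsto_id)
  simpa using (h2.sub h1).const_add (flux (leftProb S R Pm φ) M t)

lemma tendsto_flux_surround (h : Setup S R Pm) {M : ℕ} (t : Fin (2*M) → ℝ) (φ : Hp) :
    Tendsto (fun T => flux (leftProb S R Pm φ) (M+1) fun i => surround t (-T) T i.1) atTop
      (nhds (-flux (leftProb S R Pm φ) M t - ‖φ‖ ^ 2)) := by
  simp_rw [flux_surround]
  have h1 := (h.tendsto_leftProb_atBot φ).comp tendsto_neg_atTop_atBot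
  simpa using (h1.const_sub (-flux (leftProb S R Pm φ) M t)).add (h.tendsto_leftProb_atTop φ)

end Setup

lemma eventually_appendPair_mem_TM {M : ℕ} {t : Fin (2*M) → ℝ} (ht : t ∈ TM M) :
    ∀ᶠ T in atTop, appendPair t T ∈ TM (M+1) := by
  filter_upwards [eventually_all.2 fun i => eventually_gt_atTop (t i)] with T hT
  exact appendPair_mem_TM ht hT

lemma eventually_surround_mem_TM {M : ℕ} {t : Fin (2*M) → ℝ} (ht : t ∈ TM M) :
    ∀ᶠ T in atTop, (fun i : Fin (2*(M+1)) => surround t (-T) T i.1) ∈ TM (M+1) := by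
  filter_upwards [eventually_all.2 fun i => eventually_gt_atTop (t i),
    eventually_all.2 fun i => eventually_gt_atTop (-t i), eventually_gt_atTop 0] with T h1 h2 h3
  exact surround_mem_TM ht (fun i => by linarith [h2 i]) h1 (by linarith)

namespace Setup

variable {S : ℝ → Hp →L[ℂ] Hp} {R : Hp →L[ℂ] HL} {Pm : HL →L[ℂ] HL}

lemma cback_le_succ (h : Setup S R Pm) (M : ℕ) : cback S R Pm M ≤ cback S R Pm (M+1) := by
  refine h.cback_le_iff.2 fun t ht φ => le_of_tendsto (h.tendsto_flux_appendPair t φ) ?_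
  filter_upwards [eventually_appendPair_mem_TM ht] with T hT
  exact h.cback_le_iff.1 le_rfl _ hT φ

lemma cover_succ_le (h : Setup S R Pm) (M : ℕ) : cover S R Pm (M+1) ≤ cover S R Pm M := by
  refine h.le_cover_iff.2 fun t ht φ => ge_of_tendsto (h.tendsto_flux_appendPair t φ) ?_
  filter_upwards [eventually_appendPair_mem_TM ht] with T hT
  exact h.le_cover_iff.1 le_rfl _ hT φ

lemma neg_one_sub_cover_le (h : Setup S R Pm) (M : ℕ) :
    -1 - cover S R Pm M ≤ cback S R Pm (M+1) := by
  rw [sub_le_comm]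
  refine h.le_cover_iff.2 fun t ht φ => ?_
  have := le_of_tendsto (h.tendsto_flux_surround t φ)
    ((eventually_surround_mem_TM ht).mono fun T hT => h.cback_le_iff.1 le_rfl _ hT φ)
  linarith

lemma cover_le_neg_one_sub (h : Setup S R Pm) (M : ℕ) :
    cover S R Pm (M+1) ≤ -1 - cback S R Pm M := by
  rw [le_sub_comm]
  refine h.cback_le_iff.2 fun t ht φ => ?_
  have := ge_of_tendsto (h.tendsto_flux_surround t φ)
    ((eventually_surround_mem_TM ht).mono fun T hT => h.le_cover_iff.1 le_rfl _ hT φ)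
  linarith

end Setup

/-- `(c_back^{(M)})_{M≥1}` is nondecreasing, `(c_over^{(M)})_{M≥1}` is
nonincreasing, and `c_back^{(M+L)} ≥ −1 − c_over^{(M)}`, `c_over^{(M+L)} ≤ −1 − c_back^{(M)}`
for all `M, L ≥ 1`. -/
theorem backflow_overflow_constants_monotone
    (S : ℝ → Hp →L[ℂ] Hp) (R : Hp →L[ℂ] HL) (Pm : HL →L[ℂ] HL)
    (hSetup : Setup S R Pm) :
    (∀ M : ℕ, 1 ≤ M → cback S R Pm M ≤ cback S R Pm (M+1)) ∧
    (∀ M : ℕ, 1 ≤ M → cover S R Pm (M+1) ≤ cover S R Pm M) ∧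
    (∀ M L : ℕ, 1 ≤ M → 1 ≤ L → -1 - cover S R Pm M ≤ cback S R Pm (M+L)) ∧
    (∀ M L : ℕ, 1 ≤ M → 1 ≤ L → cover S R Pm (M+L) ≤ -1 - cback S R Pm M) := by
  have hmono : Monotone (cback S R Pm) := monotone_nat_of_le_succ hSetup.cback_le_succ
  have hanti : Antitone (cover S R Pm) := antitone_nat_of_succ_le hSetup.cover_succ_le
  refine ⟨fun M _ => hSetup.cback_le_succ M, fun M _ => hSetup.cover_succ_le M,
    fun M L _ hL => ?_, fun M L _ hL => ?_⟩
  · exact (hSetup.neg_one_sub_cover_le M).trans (hmono (by omega))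
  · exact (hanti (by omega : M + 1 ≤ M + L)).trans (hSetup.cover_le_neg_one_sub M)

end QB
end
end

section
/- Fix reals t₁ < τ < t₄. For every ε > 0 there exists δ > 0 such that whenever t₁ < t₂ < t₃ < t₄ with |t₂ − τ| < δ and |t₃ − τ| < δ, the Hausdorff distance between the compact sets σ(B^{(2)}_{⟨t₁,t₂,t₃,t₄⟩}) and σ(B^{(1)}_{⟨t₁,t₄⟩}) in ℝ is at least c_BM − ε. Equivalently, liminf_{t₂,t₃ → τ, t₂ < t₃} d_Haus(σ(B^{(2)}_{⟨t₁,t₂,t₃,t₄⟩}), σ(B^{(1)}_{⟨t₁,t₄⟩})) ≥ c_BM. -/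
open MeasureTheory Filter

noncomputable section

namespace QB

/-- The Bracken–Melloy constant `c_BM = sSup σ(B_{⟨0,1⟩})`. -/
def cBM (S : ℝ → Hp →L[ℂ] Hp) (R : Hp →L[ℂ] HL) (Pm : HL →L[ℂ] HL) : ℝ :=
  sSup (spectrum ℝ (B1 S R Pm 0 1))

section SpectralBounds

variable {E : Type*} [NormedAddCommGroup E] [InnerProductSpace ℂ E] [CompleteSpace E]

lemma algebraMap_le_iff_forall_reApplyInnerSelf {T : E →L[ℂ] E} (hT : IsSelfAdjoint T) (r : ℝ) :
    (∀ x ∈ spectrum ℝ T, r ≤ x) ↔ ∀ φ, r * ‖φ‖ ^ 2 ≤ T.reApplyInnerSelf φ := by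
  rw [← algebraMap_le_iff_le_spectrum (ha := hT), ContinuousLinearMap.le_def,
    ContinuousLinearMap.isPositive_def, and_iff_right]
  · refine forall_congr' fun φ => ?_
    have hr : algebraMap ℝ (E →L[ℂ] E) r φ = (r : ℂ) • φ := by
      rw [Algebra.algebraMap_eq_smul_one, Complex.coe_smul]; rfl
    rw [← sub_nonneg (b := r * ‖φ‖ ^ 2)]
    simp [ContinuousLinearMap.reApplyInnerSelf_apply, hr, inner_sub_left, inner_smul_left,
      inner_self_eq_norm_sq_to_K, ← Complex.ofReal_pow,
      -Complex.coe_smul]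
  · exact ContinuousLinearMap.isSelfAdjoint_iff_isSymmetric.1
      (hT.sub (IsSelfAdjoint.algebraMap _ (IsSelfAdjoint.all r)))

lemma le_algebraMap_iff_forall_reApplyInnerSelf {T : E →L[ℂ] E} (hT : IsSelfAdjoint T) (r : ℝ) :
    (∀ x ∈ spectrum ℝ T, x ≤ r) ↔ ∀ φ, T.reApplyInnerSelf φ ≤ r * ‖φ‖ ^ 2 := by
  have h := algebraMap_le_iff_forall_reApplyInnerSelf hT.neg (-r)
  simpa [← spectrum.neg_eq, ContinuousLinearMap.reApplyInnerSelf_apply] using h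

lemma spectrum_real_nonempty [Nontrivial E] {T : E →L[ℂ] E} (hT : IsSelfAdjoint T) :
    (spectrum ℝ T).Nonempty :=
  ContinuousFunctionalCalculus.spectrum_nonempty T hT

end SpectralBounds

section TestFunctions

/-- Continuously differentiable functions with compact support in the positive half-line. -/
structure IsTest (f : ℝ → ℂ) : Prop where
  contDiff : ContDiff ℝ 1 f
  compact : HasCompactSupport f
  pos : tsupport f ⊆ Set.Ioi 0

variable {f g : ℝ → ℂ}

lemma IsTest.zero : IsTest (0 : ℝ → ℂ) :=
  ⟨contDiff_const, HasCompactSupport.zero, by simp [tsupport]⟩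

lemma IsTest.add (hf : IsTest f) (hg : IsTest g) : IsTest (f + g) :=
  ⟨hf.contDiff.add hg.contDiff, hf.compact.add hg.compact,
    (tsupport_add f g).trans (Set.union_subset hf.pos hg.pos)⟩

lemma IsTest.const_smul (hf : IsTest f) (c : ℂ) : IsTest (c • f) :=
  ⟨hf.contDiff.const_smul c, hf.compact.smul_left (f := fun _ => c),
    (tsupport_smul_subset_right (fun _ => c) f).trans hf.pos⟩

lemma IsTest.comp_mul_left (hf : IsTest f) {r : ℝ} (hr : 0 < r) : IsTest (fun k => f (r * k)) := by
  refine ⟨hf.contDiff.comp (by fun_prop),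
    hf.compact.comp_homeomorph (Homeomorph.mulLeft₀ r hr.ne'), ?_⟩
  have h := tsupport_comp_subset_preimage f (f := fun k : ℝ => r * k) (by fun_prop)
  intro k hk
  exact (mul_pos_iff_of_pos_left hr).1 (hf.pos (h hk))

lemma IsTest.cexp_mul (hf : IsTest f) (t : ℝ) :
    IsTest (fun k => Complex.exp (-Complex.I * (k:ℂ)^2 * (t:ℂ)) * f k) := by
  refine ⟨ContDiff.mul ?_ hf.contDiff, hf.compact.mul_left,
    (tsupport_mul_subset_right).trans hf.pos⟩
  have : ContDiff ℝ 1 (fun k : ℝ => (k : ℂ)) := Complex.ofRealCLM.contDiff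
  fun_prop

lemma IsTest.memLp (hf : IsTest f) (p : ENNReal) : MemLp f p μp :=
  hf.contDiff.continuous.memLp_of_hasCompactSupport hf.compact

/-- The element of `L²((0,∞))` defined by a test function. -/
def IsTest.toHp (hf : IsTest f) : Hp := (hf.memLp 2).toLp f

lemma IsTest.coeFn_toHp (hf : IsTest f) : (hf.toHp : ℝ → ℂ) =ᵐ[μp] f := MemLp.coeFn_toLp _

/-- The subspace of `L²((0,∞))` consisting of classes of test functions. -/
def testSubmodule : Submodule ℂ Hp where
  carrier := {φ | ∃ (f : ℝ → ℂ) (hf : IsTest f), φ = hf.toHp}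
  zero_mem' := ⟨0, IsTest.zero, (MemLp.toLp_zero _).symm⟩
  add_mem' := by
    rintro _ _ ⟨f, hf, rfl⟩ ⟨g, hg, rfl⟩
    exact ⟨f + g, hf.add hg, (MemLp.toLp_add _ _).symm⟩
  smul_mem' := by
    rintro c _ ⟨f, hf, rfl⟩
    exact ⟨c • f, hf.const_smul c, (MemLp.toLp_const_smul c _).symm⟩

lemma dense_testSubmodule : Dense (testSubmodule : Set Hp) := by
  rw [Submodule.dense_iff_topologicalClosure_eq_top, Submodule.topologicalClosure_eq_top_iff,
    Submodule.eq_bot_iff]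
  intro φ hφ
  have hloc : LocallyIntegrableOn (φ : ℝ → ℂ) (Set.Ioi 0) μp :=
    ((Lp.memLp φ).locallyIntegrable (by norm_num)).locallyIntegrableOn _
  have hae := isOpen_Ioi.ae_eq_zero_of_integral_contDiff_smul_eq_zero hloc ?_
  · rw [Lp.eq_zero_iff_ae_eq_zero]
    filter_upwards [hae, ae_restrict_mem measurableSet_Ioi] with k hk hk' using hk hk'
  · intro g hg hgc hgs
    have hsupp : Function.support (fun k => (g k : ℂ)) = Function.support g := by
      ext; simp
    have hgt : IsTest (fun k => (g k : ℂ)) := by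
      refine ⟨Complex.ofRealCLM.contDiff.comp (hg.of_le (by simp)), ?_, ?_⟩
      · rwa [HasCompactSupport, tsupport, hsupp]
      · rwa [tsupport, hsupp]
    have h0 := (Submodule.mem_orthogonal _ _).1 hφ hgt.toHp ⟨_, hgt, rfl⟩
    rw [L2.inner_def] at h0
    rw [← h0]
    refine integral_congr_ae ?_
    filter_upwards [hgt.coeFn_toHp] with k hk
    rw [hk]
    simp [mul_comm]

lemma IsTest.exists_Icc (hf : IsTest f) :
    ∃ a b : ℝ, 0 < a ∧ a ≤ b ∧ ∀ k, k ∉ Set.Ioo a b → f k = 0 := by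
  obtain ⟨b, hb⟩ := hf.compact.isCompact.bddAbove
  obtain ⟨a, ha, hK⟩ : ∃ a : ℝ, 0 < a ∧ ∀ k ∈ tsupport f, a ≤ k := by
    rcases (tsupport f).eq_empty_or_nonempty with h | h
    · exact ⟨1, one_pos, by simp [h]⟩
    · obtain ⟨a, ha, h'⟩ := hf.compact.isCompact.exists_isLeast h
      exact ⟨a, hf.pos ha, h'⟩
  refine ⟨a / 2, max a b + 1, by linarith, by linarith [le_max_left a b], fun k hk => ?_⟩
  by_contra h
  have hk' := subset_tsupport f (Function.mem_support.2 h)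
  exact hk ⟨by linarith [hK k hk'], by linarith [hb hk', le_max_right a b]⟩

lemma abs_sub_two_mul {x t k : ℝ} (hxt : x * t ≤ 0) (hk : 0 ≤ k) :
    |x - 2 * k * t| = |x| + 2 * k * |t| := by
  rcases le_total 0 t with ht | ht
  · rw [abs_of_nonneg ht]
    rcases ht.eq_or_lt with rfl | ht
    · simp
    have hx : x ≤ 0 := by nlinarith
    rw [abs_of_nonpos hx, abs_of_nonpos (by nlinarith [mul_nonneg hk ht.le])]; ring
  · rw [abs_of_nonpos ht]
    rcases ht.eq_or_lt with rfl | ht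
    · simp
    have hx : 0 ≤ x := by nlinarith
    rw [abs_of_nonneg hx, abs_of_nonneg (by nlinarith)]; ring

/-- Position amplitude at `x` of the state `f` evolved for time `t`. -/
def amp (f : ℝ → ℂ) (t x : ℝ) : ℂ :=
  (((2 * Real.pi) ^ (-(1/2) : ℝ) : ℝ) : ℂ) *
    ∫ k in Set.Ioi (0:ℝ), Complex.exp (Complex.I * (x:ℂ) * (k:ℂ)) *
      (Complex.exp (-Complex.I * (k:ℂ)^2 * (t:ℂ)) * f k)

/-- Non-stationary phase bound in the region not containing classical trajectories. -/
lemma IsTest.exists_norm_amp_le (hf : IsTest f) : ∃ a C : ℝ, 0 < a ∧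
    ∀ t x : ℝ, t ≠ 0 → x * t ≤ 0 → ‖amp f t x‖ ≤ C / (|x| + a * |t|) := by
  obtain ⟨a, b, ha, hab, hsupp⟩ := hf.exists_Icc
  obtain ⟨M₁, hM₁⟩ := hf.contDiff.continuous.bounded_above_of_compact_support hf.compact
  have hd : Continuous (deriv f) := hf.contDiff.continuous_deriv le_rfl
  obtain ⟨M₂, hM₂⟩ := hd.bounded_above_of_compact_support hf.compact.deriv
  refine ⟨2 * a, (2 * Real.pi) ^ (-(1/2) : ℝ) * ((M₂ + M₁ / a) * (b - a)), by linarith, ?_⟩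
  intro t x ht hxt
  have hta : 0 < |t| := abs_pos.2 ht
  have hW : 0 < |x| + 2 * a * |t| := by positivity
  have hw : ∀ k ∈ Set.Icc a b, |x| + 2 * a * |t| ≤ |x - 2 * k * t| := fun k hk => by
    rw [abs_sub_two_mul hxt (ha.le.trans hk.1)]
    nlinarith [hk.1]
  have hne : ∀ k ∈ Set.Icc a b, ((x : ℂ) - 2 * k * t) ≠ 0 := fun k hk => by
    have h0 : x - 2 * k * t ≠ 0 := abs_pos.1 (hW.trans_le (hw k hk))
    exact_mod_cast h0
  set v : ℝ → ℂ := fun k => Complex.exp (Complex.I * (x * k - k ^ 2 * t)) with hv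
  set v' : ℝ → ℂ := fun k => v k * (Complex.I * (x - 2 * k * t)) with hv'
  set u : ℝ → ℂ := fun k => f k / (Complex.I * (x - 2 * k * t)) with hu
  set u' : ℝ → ℂ := fun k => (deriv f k * (Complex.I * (x - 2 * k * t)) -
    f k * (Complex.I * (-2 * t))) / (Complex.I * (x - 2 * k * t)) ^ 2 with hu'
  have hdv : ∀ k ∈ Set.uIcc a b, HasDerivAt v (v' k) k := fun k _ => by
    have h1 : HasDerivAt (fun k : ℝ => (k : ℂ)) 1 k := Complex.ofRealCLM.hasDerivAt
    have h2 := (((h1.const_mul (x : ℂ)).sub ((h1.pow 2).mul_const (t : ℂ))).const_mul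
      Complex.I).cexp
    refine HasDerivAt.congr_deriv (f := v) h2 ?_
    change v k * _ = v k * _
    push_cast
    ring
  have hdu : ∀ k ∈ Set.uIcc a b, HasDerivAt u (u' k) k := fun k hk => by
    rw [Set.uIcc_of_le hab] at hk
    have h1 : HasDerivAt (fun k : ℝ => (k : ℂ)) 1 k := Complex.ofRealCLM.hasDerivAt
    have h2 : HasDerivAt (fun k : ℝ => Complex.I * ((x : ℂ) - 2 * k * t))
        (Complex.I * (-2 * t)) k := by
      convert! ((((h1.const_mul 2).mul_const (t : ℂ)).const_sub (x : ℂ)).const_mul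
        Complex.I) using 1
      ring
    exact ((hf.contDiff.differentiable one_ne_zero k).hasDerivAt).div h2
      (mul_ne_zero Complex.I_ne_zero (hne k hk))
  have hcv' : IntervalIntegrable v' volume a b := by
    apply Continuous.intervalIntegrable
    simp only [hv', hv]
    fun_prop
  have hcu' : IntervalIntegrable u' volume a b := by
    apply ContinuousOn.intervalIntegrable
    rw [Set.uIcc_of_le hab]
    have hcf := hf.contDiff.continuous
    refine ContinuousOn.div (by fun_prop) (by fun_prop) fun k hk =>
      pow_ne_zero 2 (mul_ne_zero Complex.I_ne_zero (hne k hk))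
  have hparts := intervalIntegral.integral_mul_deriv_eq_deriv_mul hdu hdv hcu' hcv'
  have hua : u a = 0 := by simp [hu, hsupp a (by simp)]
  have hub : u b = 0 := by simp [hu, hsupp b (by simp)]
  rw [hua, hub, zero_mul, zero_mul, sub_zero, zero_sub] at hparts
  have hbound : ‖∫ k in a..b, u' k * v k‖ ≤
      ((M₂ + M₁ / a) / (|x| + 2 * a * |t|)) * |b - a| := by
    refine intervalIntegral.norm_integral_le_of_norm_le_const fun k hk => ?_
    rw [Set.uIoc_of_le hab] at hk
    have hk : k ∈ Set.Icc a b := ⟨hk.1.le, hk.2⟩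
    have hnv : ‖v k‖ = 1 := by
      have : v k = Complex.exp (((x * k - k ^ 2 * t : ℝ) : ℂ) * Complex.I) := by
        simp only [hv]; push_cast; ring_nf
      rw [this, Complex.norm_exp_ofReal_mul_I]
    have hnw : ‖(x : ℂ) - 2 * k * t‖ = |x - 2 * k * t| := by
      rw [← Real.norm_eq_abs, ← Complex.norm_real]; push_cast; rfl
    have hwk := hw k hk
    set w := |x - 2 * k * t|
    have hwpos : 0 < w := hW.trans_le hwk
    have hM₁0 : 0 ≤ M₁ := (norm_nonneg _).trans (hM₁ k)
    have hM₂0 : 0 ≤ M₂ := (norm_nonneg _).trans (hM₂ k)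
    rw [norm_mul, hnv, mul_one]
    calc ‖u' k‖ ≤ (M₂ * w + M₁ * (2 * |t|)) / w ^ 2 := by
          simp only [hu', norm_div, norm_pow, norm_mul, Complex.norm_I, one_mul, hnw]
          gcongr
          refine (norm_sub_le _ _).trans ?_
          simp only [norm_mul, Complex.norm_I, one_mul, hnw, norm_neg, Complex.norm_real,
            Real.norm_eq_abs, Complex.norm_ofNat]
          gcongr
          exacts [hM₂ k, hM₁ k]
      _ = (M₂ + M₁ * (2 * |t|) / w) / w := by field_simp
      _ ≤ (M₂ + M₁ * (2 * |t|) / (2 * a * |t|)) / (|x| + 2 * a * |t|) := by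
          gcongr
          exact (by linarith [abs_nonneg x] : 2 * a * |t| ≤ |x| + 2 * a * |t|).trans hwk
      _ = (M₂ + M₁ / a) / (|x| + 2 * a * |t|) := by field_simp
  have h_int : ∫ k in Set.Ioi (0:ℝ), Complex.exp (Complex.I * (x:ℂ) * (k:ℂ)) *
      (Complex.exp (-Complex.I * (k:ℂ)^2 * (t:ℂ)) * f k) = ∫ k in a..b, u k * v' k := by
    rw [intervalIntegral.integral_of_le hab]
    have hsub : Set.Ioc a b ⊆ Set.Ioi 0 := fun k hk => ha.trans hk.1
    rw [setIntegral_eq_of_subset_of_forall_sdiff_eq_zero measurableSet_Ioi hsub]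
    · refine setIntegral_congr_fun measurableSet_Ioc fun k hk => ?_
      have hk' := hne k ⟨hk.1.le, hk.2⟩
      have hI := Complex.I_ne_zero
      simp only [hu, hv', hv]
      rw [← mul_assoc, ← Complex.exp_add, show Complex.I * (x : ℂ) * k + -Complex.I * (k : ℂ) ^ 2 * t
        = Complex.I * (x * k - k ^ 2 * t) by ring]
      generalize (x : ℂ) - 2 * k * t = w at hk' ⊢
      field_simp
    · intro k hk
      rw [hsupp k fun h => hk.2 ⟨h.1, h.2.le⟩]
      simp
  have hc : (0:ℝ) ≤ (2 * Real.pi) ^ (-(1/2) : ℝ) := by positivity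
  rw [amp, norm_mul, h_int, hparts, norm_neg, Complex.norm_real, Real.norm_of_nonneg hc,
    mul_div_assoc]
  gcongr
  rw [abs_of_nonneg (sub_nonneg.2 hab)] at hbound
  refine hbound.trans_eq (by ring)

end TestFunctions

section Operators

lemma norm_sq_eq_integral {μ : Measure ℝ} (ψ : Lp ℂ 2 μ) : ‖ψ‖ ^ 2 = ∫ x, ‖ψ x‖ ^ 2 ∂μ := by
  have h : inner ℂ ψ ψ = ((∫ x, ‖ψ x‖ ^ 2 ∂μ : ℝ) : ℂ) := by
    rw [L2.inner_def, ← integral_complex_ofReal]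
    simp [inner_self_eq_norm_sq_to_K]
  rw [inner_self_eq_norm_sq_to_K] at h
  exact Complex.ofReal_injective (by rw [← h]; push_cast; rfl)

lemma integral_le_of_norm_le_div {F : ℝ → ℂ} {s : Set ℝ} (hs : MeasurableSet s) {c C : ℝ}
    (hc : 0 < c) (h : ∀ x ∈ s, ‖F x‖ ≤ C / (|x| + c)) :
    ∫ x in s, ‖F x‖ ^ 2 ≤ C ^ 2 * Real.pi / c := by
  have h_int : Integrable (fun x : ℝ => (C / c) ^ 2 * (1 + (x / c) ^ 2)⁻¹) :=
    (integrable_inv_one_add_sq.comp_div hc.ne').const_mul _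
  calc ∫ x in s, ‖F x‖ ^ 2 ≤ ∫ x in s, (C / c) ^ 2 * (1 + (x / c) ^ 2)⁻¹ := by
        refine integral_mono_of_nonneg (ae_of_all _ fun x => by positivity) h_int.integrableOn ?_
        filter_upwards [ae_restrict_mem hs] with x hx
        have h0 : 0 < |x| + c := by positivity
        calc ‖F x‖ ^ 2 ≤ (C / (|x| + c)) ^ 2 := by gcongr; exact h x hx
          _ = C ^ 2 / (|x| + c) ^ 2 := by rw [div_pow]
          _ ≤ C ^ 2 / (c ^ 2 + x ^ 2) := by
            gcongr
            nlinarith [sq_abs x, mul_nonneg (abs_nonneg x) hc.le]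
          _ = (C / c) ^ 2 * (1 + (x / c) ^ 2)⁻¹ := by field_simp
    _ ≤ ∫ x : ℝ, (C / c) ^ 2 * (1 + (x / c) ^ 2)⁻¹ :=
        setIntegral_le_integral h_int (ae_of_all _ fun x => by positivity)
    _ = C ^ 2 * Real.pi / c := by
        rw [integral_const_mul, Measure.integral_comp_div (fun x : ℝ => (1 + x ^ 2)⁻¹),
          integral_univ_inv_one_add_sq, abs_of_pos hc, smul_eq_mul]
        field_simp

variable {S : ℝ → Hp →L[ℂ] Hp} {R : Hp →L[ℂ] HL} {Pm : HL →L[ℂ] HL}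

lemma Setup.inner_Pm_sub (h : Setup S R Pm) (ψ χ : HL) : inner ℂ (Pm ψ) (χ - Pm χ) = 0 := by
  rw [L2.inner_def]
  refine integral_eq_zero_of_ae ?_
  filter_upwards [h.hPm ψ, h.hPm χ, Lp.coeFn_sub χ (Pm χ)] with x h1 h2 h3
  rw [h1, h3, Pi.sub_apply, h2]
  by_cases hx : x ∈ Set.Iio (0:ℝ) <;> simp [Set.indicator, hx]

lemma Setup.inner_Pm_left (h : Setup S R Pm) (ψ χ : HL) :
    inner ℂ (Pm ψ) χ = inner ℂ (Pm ψ) (Pm χ) := by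
  rw [← sub_eq_zero, ← inner_sub_right, h.inner_Pm_sub]

lemma Setup.norm_sq_add (h : Setup S R Pm) (ψ : HL) :
    ‖Pm ψ‖ ^ 2 + ‖ψ - Pm ψ‖ ^ 2 = ‖ψ‖ ^ 2 := by
  have := norm_add_sq_eq_norm_sq_add_norm_sq_of_inner_eq_zero _ _ (h.inner_Pm_sub ψ ψ)
  rw [add_sub_cancel] at this
  linarith [sq ‖Pm ψ‖, sq ‖ψ - Pm ψ‖, sq ‖ψ‖]

lemma Setup.norm_Pm_le_s14 (h : Setup S R Pm) (ψ : HL) : ‖Pm ψ‖ ≤ ‖ψ‖ := by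
  refine le_of_sq_le_sq ?_ (norm_nonneg _)
  nlinarith [h.norm_sq_add ψ]

lemma Setup.isSelfAdjoint_Pm (h : Setup S R Pm) : IsSelfAdjoint Pm := by
  rw [ContinuousLinearMap.isSelfAdjoint_iff_isSymmetric]
  intro ψ χ
  change inner ℂ (Pm ψ) χ = inner ℂ ψ (Pm χ)
  rw [h.inner_Pm_left ψ χ, ← inner_conj_symm ψ, h.inner_Pm_left χ ψ, inner_conj_symm]

lemma Setup.norm_S_s14 (h : Setup S R Pm) (t : ℝ) (φ : Hp) : ‖S t φ‖ = ‖φ‖ := by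
  rw [← sq_eq_sq₀ (norm_nonneg _) (norm_nonneg _), norm_sq_eq_integral, norm_sq_eq_integral]
  refine integral_congr_ae ?_
  filter_upwards [h.hS t φ] with k hk
  have : -Complex.I * (k:ℂ)^2 * (t:ℂ) = ((-(k ^ 2 * t) : ℝ) : ℂ) * Complex.I := by
    push_cast; ring
  rw [hk, norm_mul, this, Complex.norm_exp_ofReal_mul_I, one_mul]

lemma Setup.isSelfAdjoint_B1 (h : Setup S R Pm) (s t : ℝ) : IsSelfAdjoint (B1 S R Pm s t) := by
  have := fun r => (h.isSelfAdjoint_Pm.adjoint_conj R).adjoint_conj (S r)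
  exact (this t).sub (this s)

lemma Setup.reApplyInnerSelf_B1 (h : Setup S R Pm) (s t : ℝ) (φ : Hp) :
    (B1 S R Pm s t).reApplyInnerSelf φ = ‖Pm (R (S t φ))‖ ^ 2 - ‖Pm (R (S s φ))‖ ^ 2 := by
  simp only [ContinuousLinearMap.reApplyInnerSelf_apply, B1, sub_apply,
    ContinuousLinearMap.comp_apply, inner_sub_left, map_sub,
    ContinuousLinearMap.adjoint_inner_left]
  rw [h.inner_Pm_left _ (R (S t φ)), h.inner_Pm_left _ (R (S s φ)), inner_self_eq_norm_sq,
    inner_self_eq_norm_sq]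

lemma Setup.S_toHp (h : Setup S R Pm) (t : ℝ) {f : ℝ → ℂ} (hf : IsTest f) :
    S t hf.toHp = (hf.cexp_mul t).toHp := by
  refine Lp.ext ?_
  filter_upwards [h.hS t hf.toHp, hf.coeFn_toHp, (hf.cexp_mul t).coeFn_toHp] with k h1 h2 h3
  rw [h1, h2, h3]

lemma Setup.coeFn_R_S_toHp (h : Setup S R Pm) (t : ℝ) {f : ℝ → ℂ} (hf : IsTest f) :
    (R (S t hf.toHp) : ℝ → ℂ) =ᵐ[volume] amp f t := by
  rw [h.S_toHp t hf]
  have hft := hf.cexp_mul t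
  have h_int : Integrable (hft.toHp : ℝ → ℂ) μp :=
    (memLp_one_iff_integrable.1 (hft.memLp 1)).congr hft.coeFn_toHp.symm
  filter_upwards [h.hR _ h_int] with x hx
  rw [hx, amp]
  congr 1
  refine integral_congr_ae ?_
  filter_upwards [hft.coeFn_toHp] with k hk
  rw [hk]

lemma Setup.norm_Pm_toHp_sq (h : Setup S R Pm) (t : ℝ) {f : ℝ → ℂ} (hf : IsTest f) :
    ‖Pm (R (S t hf.toHp))‖ ^ 2 = ∫ x in Set.Iio 0, ‖amp f t x‖ ^ 2 := by
  rw [norm_sq_eq_integral, ← integral_indicator measurableSet_Iio]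
  refine integral_congr_ae ?_
  filter_upwards [h.hPm (R (S t hf.toHp)), h.coeFn_R_S_toHp t hf] with x h1 h2
  rw [h1]
  by_cases hx : x ∈ Set.Iio (0:ℝ) <;> simp [Set.indicator, hx, h2]

lemma Setup.norm_sub_Pm_toHp_sq (h : Setup S R Pm) (t : ℝ) {f : ℝ → ℂ} (hf : IsTest f) :
    ‖R (S t hf.toHp) - Pm (R (S t hf.toHp))‖ ^ 2 = ∫ x in Set.Ici 0, ‖amp f t x‖ ^ 2 := by
  rw [norm_sq_eq_integral, ← integral_indicator measurableSet_Ici]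
  refine integral_congr_ae ?_
  filter_upwards [h.hPm (R (S t hf.toHp)), h.coeFn_R_S_toHp t hf,
    Lp.coeFn_sub (R (S t hf.toHp)) (Pm (R (S t hf.toHp)))] with x h1 h2 h3
  rw [h3, Pi.sub_apply, h1]
  by_cases hx : x < 0
  · simp [Set.indicator, hx, hx.not_ge]
  · simp [Set.indicator, hx, not_lt.1 hx, h2]

/-- Probability of finding a test state in the left half-line vanishes for large times. -/
lemma Setup.tendsto_atTop (h : Setup S R Pm) {f : ℝ → ℂ} (hf : IsTest f) :
    Tendsto (fun t => ‖Pm (R (S t hf.toHp))‖ ^ 2) atTop (nhds 0) := by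
  obtain ⟨a, C, ha, hC⟩ := hf.exists_norm_amp_le
  have hlim : Tendsto (fun t : ℝ => C ^ 2 * Real.pi / (a * |t|)) atTop (nhds 0) :=
    tendsto_const_nhds.div_atTop (tendsto_abs_atTop_atTop.const_mul_atTop ha)
  refine squeeze_zero' (Eventually.of_forall fun t => by positivity) ?_ hlim
  filter_upwards [eventually_gt_atTop 0] with t ht
  rw [h.norm_Pm_toHp_sq]
  refine integral_le_of_norm_le_div measurableSet_Iio (by positivity) fun x hx => ?_
  exact hC t x ht.ne' (mul_nonpos_of_nonpos_of_nonneg (Set.mem_Iio.1 hx).le ht.le)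

/-- A test state is located in the left half-line in the distant past. -/
lemma Setup.tendsto_atBot (h : Setup S R Pm) {f : ℝ → ℂ} (hf : IsTest f) :
    Tendsto (fun t => ‖Pm (R (S t hf.toHp))‖ ^ 2) atBot (nhds (‖hf.toHp‖ ^ 2)) := by
  have key : Tendsto (fun t => ‖R (S t hf.toHp) - Pm (R (S t hf.toHp))‖ ^ 2) atBot (nhds 0) := by
    obtain ⟨a, C, ha, hC⟩ := hf.exists_norm_amp_le
    have hlim : Tendsto (fun t : ℝ => C ^ 2 * Real.pi / (a * |t|)) atBot (nhds 0) :=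
      tendsto_const_nhds.div_atTop (tendsto_abs_atBot_atTop.const_mul_atTop ha)
    refine squeeze_zero' (Eventually.of_forall fun t => by positivity) ?_ hlim
    filter_upwards [eventually_lt_atBot 0] with t ht
    have ht' : 0 < |t| := abs_pos.2 ht.ne
    rw [h.norm_sub_Pm_toHp_sq]
    refine integral_le_of_norm_le_div measurableSet_Ici (by positivity) fun x hx => ?_
    exact hC t x ht.ne (mul_nonpos_of_nonneg_of_nonpos hx ht.le)
  have := key.const_sub (‖hf.toHp‖ ^ 2)
  rw [sub_zero] at this
  refine this.congr fun t => ?_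
  rw [sub_eq_iff_eq_add, h.norm_sq_add, h.hR_isometry, h.norm_S_s14]

lemma amp_comp_mul (f : ℝ → ℂ) {r : ℝ} (hr : 0 < r) (t x : ℝ) :
    amp (fun k => f (r * k)) t x = (r : ℂ)⁻¹ * amp f (t / r ^ 2) (x / r) := by
  have hr' : (r : ℂ) ≠ 0 := by exact_mod_cast hr.ne'
  have := integral_comp_mul_left_Ioi (fun k : ℝ => Complex.exp (Complex.I * ((x / r : ℝ):ℂ) * (k:ℂ)) *
      (Complex.exp (-Complex.I * (k:ℂ)^2 * ((t / r ^ 2 : ℝ):ℂ)) * f k)) 0 hr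
  rw [mul_zero] at this
  rw [amp, amp, mul_left_comm, ← Complex.ofReal_inv, ← Complex.real_smul (x := r⁻¹), ← this]
  congr 1
  refine integral_congr_ae (ae_of_all _ fun k => ?_)
  push_cast
  field_simp

lemma Setup.norm_Pm_scaled_sq (h : Setup S R Pm) {f : ℝ → ℂ} (hf : IsTest f) {r : ℝ} (hr : 0 < r)
    (t : ℝ) : ‖Pm (R (S t (hf.comp_mul_left hr).toHp))‖ ^ 2
      = r⁻¹ * ‖Pm (R (S (t / r ^ 2) hf.toHp))‖ ^ 2 := by
  rw [h.norm_Pm_toHp_sq, h.norm_Pm_toHp_sq, ← integral_indicator measurableSet_Iio,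
    ← integral_indicator measurableSet_Iio]
  have := Measure.integral_comp_div
    ((Set.Iio (0:ℝ)).indicator fun x => ‖amp f (t / r ^ 2) x‖ ^ 2) r
  rw [abs_of_pos hr, smul_eq_mul] at this
  rw [eq_inv_mul_iff_mul_eq₀ hr.ne', ← mul_right_inj' hr.ne', ← this, ← integral_const_mul,
    ← integral_const_mul]
  congr 1
  ext x
  have hx : x / r < 0 ↔ x < 0 := by simp [div_neg_iff, hr, hr.not_gt]
  by_cases hx0 : x < 0
  · simp only [Set.indicator, Set.mem_Iio, hx, hx0, if_true, amp_comp_mul f hr, norm_mul, norm_inv,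
      Complex.norm_real, Real.norm_of_nonneg hr.le]
    field_simp
  · simp [Set.indicator, hx, hx0]

lemma IsTest.norm_scaled_sq {f : ℝ → ℂ} (hf : IsTest f) {r : ℝ} (hr : 0 < r) :
    ‖(hf.comp_mul_left hr).toHp‖ ^ 2 = r⁻¹ * ‖hf.toHp‖ ^ 2 := by
  have key : ∀ {g : ℝ → ℂ} (hg : IsTest g), ‖hg.toHp‖ ^ 2 = ∫ k in Set.Ioi (0:ℝ), ‖g k‖ ^ 2 := by
    intro g hg
    rw [norm_sq_eq_integral]
    refine integral_congr_ae ?_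
    filter_upwards [hg.coeFn_toHp] with k hk
    rw [hk]
  rw [key, key, integral_comp_mul_left_Ioi (fun k => ‖f k‖ ^ 2) 0 hr, mul_zero, smul_eq_mul]

/-- Concentrating a test state at high momenta, around the time `s`. -/
lemma Setup.exists_scaled (h : Setup S R Pm) {f : ℝ → ℂ} (hf : IsTest f) (s : ℝ) {T : ℝ}
    (hT : 0 < T) : ∃ (ψ : Hp) (c : ℝ), 0 < c ∧ ‖ψ‖ ^ 2 = c * ‖hf.toHp‖ ^ 2 ∧
      ∀ t, ‖Pm (R (S t ψ))‖ ^ 2 = c * ‖Pm (R (S ((t - s) / T) hf.toHp))‖ ^ 2 := by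
  have hr : 0 < √T := Real.sqrt_pos.2 hT
  have hg := hf.comp_mul_left hr
  refine ⟨S (-s) hg.toHp, (√T)⁻¹, inv_pos.2 hr, ?_, fun t => ?_⟩
  · rw [h.norm_S_s14, hf.norm_scaled_sq hr]
  · have hS : S t (S (-s) hg.toHp) = S (t - s) hg.toHp := by
      refine Lp.ext ?_
      filter_upwards [h.hS t (S (-s) hg.toHp), h.hS (-s) hg.toHp, h.hS (t - s) hg.toHp]
        with k h1 h2 h3
      rw [h1, h2, h3, ← mul_assoc, ← Complex.exp_add]
      congr 2
      push_cast
      ring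
    rw [hS, h.norm_Pm_scaled_sq hf hr, Real.sq_sqrt hT.le]

end Operators

lemma Setup.neg_one_le_of_mem_spectrum_B1 {S : ℝ → Hp →L[ℂ] Hp} {R : Hp →L[ℂ] HL}
    {Pm : HL →L[ℂ] HL} (h : Setup S R Pm) (s t : ℝ) {x : ℝ}
    (hx : x ∈ spectrum ℝ (B1 S R Pm s t)) : -1 ≤ x := by
  refine (algebraMap_le_iff_forall_reApplyInnerSelf (h.isSelfAdjoint_B1 s t) (-1)).2
    (fun φ => ?_) x hx
  have hle : ‖Pm (R (S s φ))‖ ≤ ‖φ‖ :=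
    (h.norm_Pm_le_s14 _).trans_eq (by rw [h.hR_isometry, h.norm_S_s14])
  have hsq := pow_le_pow_left₀ (norm_nonneg _) hle 2
  rw [h.reApplyInnerSelf_B1]
  linarith [sq_nonneg ‖Pm (R (S t φ))‖]

/-- as the two backflow intervals merge (`t₂, t₃ → τ`), the Hausdorff distance
between `σ(B^{(2)}_{⟨t₁,t₂,t₃,t₄⟩})` and `σ(B^{(1)}_{⟨t₁,t₄⟩})` is eventually at least
`c_BM − ε`; i.e. the liminf of the Hausdorff distances is at least `c_BM`. -/
theorem merging_intervals_hausdorff_distance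
    (S : ℝ → Hp →L[ℂ] Hp) (R : Hp →L[ℂ] HL) (Pm : HL →L[ℂ] HL)
    (hSetup : Setup S R Pm)
    (t₁ τ t₄ : ℝ) (h1 : t₁ < τ) (h4 : τ < t₄) :
    ∀ ε : ℝ, 0 < ε → ∃ δ : ℝ, 0 < δ ∧
      ∀ t₂ t₃ : ℝ, t₁ < t₂ → t₂ < t₃ → t₃ < t₄ → |t₂ - τ| < δ → |t₃ - τ| < δ →
        cBM S R Pm - ε ≤
          Metric.hausdorffDist (spectrum ℝ (B1 S R Pm t₁ t₂ + B1 S R Pm t₃ t₄))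
            (spectrum ℝ (B1 S R Pm t₁ t₄)) := by
  intro ε hε
  set c := cBM S R Pm with hc
  rcases le_or_gt c ε with hcε | hcε
  · exact ⟨1, one_pos, fun _ _ _ _ _ _ _ =>
      (sub_nonpos.2 hcε).trans Metric.hausdorffDist_nonneg⟩
  obtain ⟨f, hf, hf01⟩ : ∃ (f : ℝ → ℂ) (hf : IsTest f),
      (c - ε / 2) * ‖hf.toHp‖ ^ 2 < (B1 S R Pm 0 1).reApplyInnerSelf hf.toHp := by
    have hne : (spectrum ℝ (B1 S R Pm 0 1)).Nonempty := by
      rw [Set.nonempty_iff_ne_empty]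
      intro h
      rw [cBM, h, Real.sSup_empty] at hc
      linarith
    obtain ⟨x, hx, hcx⟩ := exists_lt_of_lt_csSup hne
      (show c - ε / 2 < sSup (spectrum ℝ (B1 S R Pm 0 1)) from sub_lt_self c (half_pos hε))
    have hφ : ¬ ∀ φ, (B1 S R Pm 0 1).reApplyInnerSelf φ ≤ (c - ε / 2) * ‖φ‖ ^ 2 := fun h =>
      hcx.not_ge ((le_algebraMap_iff_forall_reApplyInnerSelf
        (hSetup.isSelfAdjoint_B1 0 1) _).2 h x hx)
    push Not at hφ
    have hopen : IsOpen {φ : Hp | (c - ε / 2) * ‖φ‖ ^ 2 < (B1 S R Pm 0 1).reApplyInnerSelf φ} :=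
      isOpen_lt (by fun_prop) (B1 S R Pm 0 1).reApplyInnerSelf_continuous
    obtain ⟨_, ⟨f, hf, rfl⟩, h⟩ := dense_testSubmodule.exists_mem_open hopen hφ
    exact ⟨f, hf, h⟩
  set n := ‖hf.toHp‖ ^ 2 with hn
  have hn0 : hf.toHp ≠ 0 := by
    intro h
    simp [hn, h, ContinuousLinearMap.reApplyInnerSelf_apply] at hf01
  have hnpos : 0 < n := by positivity
  have : Nontrivial Hp := ⟨_, _, hn0⟩
  set p : ℝ → ℝ := fun t => ‖Pm (R (S t hf.toHp))‖ ^ 2 with hp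
  rw [hSetup.reApplyInnerSelf_B1] at hf01
  obtain ⟨A, hA⟩ := eventually_atTop.1 ((hSetup.tendsto_atTop hf).eventually_lt_const
    (show 0 < ε / 4 * n by positivity))
  obtain ⟨B, hB⟩ := eventually_atBot.1 ((hSetup.tendsto_atBot hf).eventually_const_lt
    (show n - ε / 4 * n < n by linarith [show 0 < ε / 4 * n by positivity]))
  obtain ⟨M, hM0, hMA, hMB⟩ : ∃ M : ℝ, 0 < M ∧ A ≤ M ∧ -B ≤ M :=
    ⟨max 1 (max A (-B)), by positivity, by simp, by simp⟩
  refine ⟨min (t₄ - τ) (τ - t₁) / (2 + 2 * M), div_pos (lt_min (by linarith) (by linarith))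
    (by linarith), fun t₂ t₃ h12 h23 h34 h2 h3 => ?_⟩
  rw [lt_div_iff₀ (by linarith), lt_min_iff] at h2 h3
  have hT : 0 < t₃ - t₂ := by linarith
  have hT2 : t₃ - t₂ ≤ |t₂ - τ| + |t₃ - τ| := by
    linarith [neg_abs_le (t₂ - τ), le_abs_self (t₃ - τ)]
  have hT2M := mul_le_mul_of_nonneg_right hT2 hM0.le
  have hA' : A ≤ (t₄ - t₂) / (t₃ - t₂) := by
    refine hMA.trans ?_
    rw [le_div_iff₀ hT]
    linarith [le_abs_self (t₂ - τ), neg_abs_le (t₂ - τ), h2.1, h3.1, abs_nonneg (t₃ - τ)]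
  have hB' : (t₁ - t₂) / (t₃ - t₂) ≤ B := by
    refine le_trans ?_ (neg_le.1 hMB)
    rw [div_le_iff₀ hT]
    linarith [le_abs_self (t₂ - τ), neg_abs_le (t₂ - τ), h2.2, h3.2, abs_nonneg (t₃ - τ)]
  obtain ⟨ψ, r, hr, hψ, hψp⟩ := hSetup.exists_scaled hf t₂ hT
  have hsa : IsSelfAdjoint (B1 S R Pm t₁ t₂ + B1 S R Pm t₃ t₄) :=
    (hSetup.isSelfAdjoint_B1 _ _).add (hSetup.isSelfAdjoint_B1 _ _)
  have hlow : (B1 S R Pm t₁ t₂ + B1 S R Pm t₃ t₄).reApplyInnerSelf ψ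
      < (-1 - c + ε) * ‖ψ‖ ^ 2 := by
    have hadd : (B1 S R Pm t₁ t₂ + B1 S R Pm t₃ t₄).reApplyInnerSelf ψ =
        (B1 S R Pm t₁ t₂).reApplyInnerSelf ψ + (B1 S R Pm t₃ t₄).reApplyInnerSelf ψ := by
      simp [ContinuousLinearMap.reApplyInnerSelf_apply, inner_add_left]
    rw [hadd, hSetup.reApplyInnerSelf_B1, hSetup.reApplyInnerSelf_B1, hψp, hψp, hψp, hψp, hψ,
      sub_self, zero_div, div_self hT.ne']
    have h1 := hA _ hA'
    have h2 := hB _ hB'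
    have := mul_lt_mul_of_pos_left (show p 0 - p ((t₁ - t₂) / (t₃ - t₂)) +
      (p ((t₄ - t₂) / (t₃ - t₂)) - p 1) < (-1 - c + ε) * n by simp only [hp]; linarith) hr
    simp only [hp] at this
    linarith
  obtain ⟨y, hy, hyc⟩ : ∃ y ∈ spectrum ℝ (B1 S R Pm t₁ t₂ + B1 S R Pm t₃ t₄),
      y < -1 - c + ε := by
    by_contra! hcon
    exact hlow.not_ge ((algebraMap_le_iff_forall_reApplyInnerSelf hsa _).1 hcon ψ)
  have hne : (spectrum ℝ (B1 S R Pm t₁ t₄)).Nonempty :=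
    spectrum_real_nonempty (hSetup.isSelfAdjoint_B1 _ _)
  refine le_trans ?_ (Metric.infDist_le_hausdorffDist_of_mem hy
    (Metric.hausdorffEDist_ne_top_of_nonempty_of_bounded ⟨y, hy⟩ hne
      (spectrum.isBounded _) (spectrum.isBounded _)))
  refine (Metric.le_infDist hne).2 fun z hz => ?_
  rw [dist_comm, Real.dist_eq]
  linarith [hSetup.neg_one_le_of_mem_spectrum_B1 _ _ hz, le_abs_self (z - y)]

end QB
end
end

section
/- For every Λ > 0, with P_Λ the orthogonal projection on L²((0,∞)) given by multiplication by the indicator function of (0,Λ), the map (s,t) ↦ P_Λ B_{⟨s,t⟩} P_Λ is continuous from {(s,t) ∈ ℝ² : s < t} to the bounded operators on L²((0,∞)) with the operator-norm topology. -/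
open MeasureTheory Filter

noncomputable section

namespace QB

/-- The phase `t ↦ e^{-i k² t}` is Lipschitz with constant `k²`. -/
lemma norm_phase_sub_phase_le (k s t : ℝ) :
    ‖Complex.exp (-Complex.I * (k:ℂ)^2 * (t:ℂ)) - Complex.exp (-Complex.I * (k:ℂ)^2 * (s:ℂ))‖
      ≤ k ^ 2 * |t - s| := by
  have hfac : Complex.exp (-Complex.I * (k:ℂ)^2 * (t:ℂ))
      - Complex.exp (-Complex.I * (k:ℂ)^2 * (s:ℂ))
      = Complex.exp (((-(k ^ 2 * s) : ℝ) : ℂ) * Complex.I)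
        * (Complex.exp (Complex.I * ((-(k ^ 2 * (t - s)) : ℝ) : ℂ)) - 1) := by
    rw [mul_sub, ← Complex.exp_add, mul_one]
    push_cast
    ring_nf
  rw [hfac, norm_mul, Complex.norm_exp_ofReal_mul_I, one_mul]
  refine (Real.norm_exp_I_mul_ofReal_sub_one_le).trans_eq ?_
  rw [norm_neg, norm_mul, Real.norm_eq_abs, Real.norm_eq_abs, abs_of_nonneg (sq_nonneg k)]

/-- Multiplication by an indicator function is a self-adjoint operator on `L²`. -/
lemma adjoint_eq_self_of_ae_eq_indicator {α : Type*} [MeasurableSpace α] {μ : Measure α}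
    {A : Set α} {P : Lp ℂ 2 μ →L[ℂ] Lp ℂ 2 μ}
    (hP : ∀ φ : Lp ℂ 2 μ, (P φ : α → ℂ) =ᵐ[μ] A.indicator (fun k => φ k)) :
    ContinuousLinearMap.adjoint P = P := by
  symm
  rw [ContinuousLinearMap.eq_adjoint_iff]
  intro φ ψ
  rw [L2.inner_def, L2.inner_def]
  refine integral_congr_ae ?_
  filter_upwards [hP φ, hP ψ] with k hφ hψ
  rw [hφ, hψ]
  by_cases hk : k ∈ A <;> simp [hk]

/-- On wave numbers below `Λ`, the free evolution is norm-continuous in time. -/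
lemma continuous_evolution_comp_cutoff {S : ℝ → Hp →L[ℂ] Hp}
    (hS : ∀ (t : ℝ) (φ : Hp),
      (S t φ : ℝ → ℂ) =ᵐ[μp] fun k => Complex.exp (-Complex.I * (k:ℂ)^2 * (t:ℂ)) * φ k)
    {Λ : ℝ} {PΛ : Hp →L[ℂ] Hp}
    (hPΛ : ∀ φ : Hp,
      (PΛ φ : ℝ → ℂ) =ᵐ[μp] Set.indicator (Set.Ioo (0:ℝ) Λ) (fun k => φ k)) :
    Continuous fun t => (S t).comp PΛ := by
  refine (LipschitzWith.of_dist_le_mul (K := Real.toNNReal (Λ ^ 2)) fun t s => ?_).continuous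
  rw [dist_eq_norm, Real.dist_eq, Real.coe_toNNReal _ (sq_nonneg Λ)]
  refine ContinuousLinearMap.opNorm_le_bound _ (by positivity) fun φ => ?_
  refine Lp.norm_le_mul_norm_of_ae_le_mul ?_
  change ∀ᵐ k ∂μp, ‖(S t (PΛ φ) - S s (PΛ φ) : Hp) k‖ ≤ _
  filter_upwards [Lp.coeFn_sub (S t (PΛ φ)) (S s (PΛ φ)), hS t (PΛ φ), hS s (PΛ φ), hPΛ φ]
    with k hsub ht hs hP
  rw [hsub, Pi.sub_apply, ht, hs, ← sub_mul, norm_mul, hP]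
  by_cases hk : k ∈ Set.Ioo (0:ℝ) Λ
  · rw [Set.indicator_of_mem hk]
    gcongr
    refine (norm_phase_sub_phase_le k s t).trans ?_
    have := hk.1.le
    have := hk.2.le
    gcongr
  · rw [Set.indicator_of_notMem hk, norm_zero, mul_zero]
    positivity

/-- Conjugating a fixed operator by a norm-continuous family is norm-continuous. -/
lemma continuous_adjoint_comp_comp {X E : Type*} [TopologicalSpace X] [NormedAddCommGroup E]
    [InnerProductSpace ℂ E] [CompleteSpace E] {T : X → E →L[ℂ] E} (hT : Continuous T)
    (A : E →L[ℂ] E) :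
    Continuous fun x => (ContinuousLinearMap.adjoint (T x)).comp (A.comp (T x)) :=
  ((ContinuousLinearMap.adjoint (𝕜 := ℂ) (E := E) (F := E)).continuous.comp hT).clm_comp
    (continuous_const.clm_comp hT)

/-- The cut-off backflow operator is a difference of conjugates of `R* Π⁻ R`. -/
lemma cutoff_comp_B1_comp_cutoff {S : ℝ → Hp →L[ℂ] Hp} {R : Hp →L[ℂ] HL} {Pm : HL →L[ℂ] HL}
    {P : Hp →L[ℂ] Hp} (hP : ContinuousLinearMap.adjoint P = P) (s t : ℝ) :
    P.comp ((B1 S R Pm s t).comp P) =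
      (ContinuousLinearMap.adjoint ((S t).comp P)).comp
        (((ContinuousLinearMap.adjoint R).comp (Pm.comp R)).comp ((S t).comp P))
      - (ContinuousLinearMap.adjoint ((S s).comp P)).comp
        (((ContinuousLinearMap.adjoint R).comp (Pm.comp R)).comp ((S s).comp P)) := by
  rw [ContinuousLinearMap.adjoint_comp, ContinuousLinearMap.adjoint_comp, hP, B1,
    ContinuousLinearMap.sub_comp, ContinuousLinearMap.comp_sub]
  rfl

/-- with `P_Λ` the multiplication by the indicator of `(0,Λ)`, the map
`(s,t) ↦ P_Λ B_{⟨s,t⟩} P_Λ` is continuous from `{(s,t) : s < t}` into the bounded operators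
with the operator-norm topology. -/
theorem cutoff_backflow_norm_continuous
    (S : ℝ → Hp →L[ℂ] Hp) (R : Hp →L[ℂ] HL) (Pm : HL →L[ℂ] HL)
    (hSetup : Setup S R Pm)
    (Λ : ℝ) (hΛ : 0 < Λ) (PΛ : Hp →L[ℂ] Hp)
    (hPΛ : ∀ φ : Hp,
      (PΛ φ : ℝ → ℂ) =ᵐ[μp] Set.indicator (Set.Ioo (0:ℝ) Λ) (fun k => φ k)) :
    ContinuousOn (fun p : ℝ × ℝ => PΛ.comp ((B1 S R Pm p.1 p.2).comp PΛ))
      {p : ℝ × ℝ | p.1 < p.2} := by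
  have hterm := continuous_adjoint_comp_comp
    (continuous_evolution_comp_cutoff hSetup.hS hPΛ)
    ((ContinuousLinearMap.adjoint R).comp (Pm.comp R))
  simp_rw [cutoff_comp_B1_comp_cutoff (adjoint_eq_self_of_ae_eq_indicator hPΛ)]
  exact ((hterm.comp continuous_snd).sub (hterm.comp continuous_fst)).continuousOn

end QB
end
end
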